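/- Let G be a 2-connected claw-free graph on n ≥ 33 vertices. If μ(G) ≥ μ(EP_n), then G is Hamiltonian, unless G is isomorphic to EP_n. -/

import Mathlib

open SimpleGraph

/-- A graph is claw-free if it contains no induced `K_{1,3}`. -/
def ClawFree {V : Type*} (G : SimpleGraph V) : Prop :=
  ¬ ∃ v a b c : V, a ≠ b ∧ a ≠ c ∧ b ≠ c ∧
    G.Adj v a ∧ G.Adj v b ∧ G.Adj v c ∧ ¬ G.Adj a b ∧ ¬ G.Adj a c ∧ ¬ G.Adj b c

/-- A graph is traceable if it has a Hamilton path. -/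
def Traceable {V : Type*} (G : SimpleGraph V) : Prop := by
  classical
  exact ∃ (u v : V) (p : G.Walk u v), p.IsHamiltonian

/-- A graph is 2-connected if it has at least 3 vertices and deleting any
single vertex leaves a connected graph. -/
def TwoConnected {V : Type*} [Fintype V] [DecidableEq V] (G : SimpleGraph V) : Prop :=
  3 ≤ Fintype.card V ∧ ∀ v : V, (G.induce ({v}ᶜ : Set V)).Connected

/-- A vertex is eligible if its neighbourhood induces a connected non-complete graph. -/
def Eligible {V : Type*} (G : SimpleGraph V) (x : V) : Prop :=
  (G.induce (G.neighborSet x)).Connected ∧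
    ∃ u v : V, G.Adj x u ∧ G.Adj x v ∧ u ≠ v ∧ ¬ G.Adj u v

/-- A claw-free graph is closed if it has no eligible vertex. -/
def IsClosedGraph {V : Type*} (G : SimpleGraph V) : Prop := ∀ x : V, ¬ Eligible G x

/-- The spectral radius of a graph: the largest eigenvalue of its adjacency matrix. -/
noncomputable def adjSpectralRadius {V : Type*} [Fintype V] [DecidableEq V] (G : SimpleGraph V) : ℝ := by
  classical
  exact sSup {μ : ℝ | ∃ x : V → ℝ, x ≠ 0 ∧ (G.adjMatrix ℝ).mulVec x = μ • x}

/-- The `Q`-index of a graph: the largest eigenvalue of `Q = D + A`. -/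
noncomputable def qIndex {V : Type*} [Fintype V] [DecidableEq V] (G : SimpleGraph V) : ℝ := by
  classical
  exact sSup {μ : ℝ | ∃ x : V → ℝ, x ≠ 0 ∧
    (Matrix.diagonal (fun v => (G.degree v : ℝ)) + G.adjMatrix ℝ).mulVec x = μ • x}

/-- `EN n`: the complete graph on `{0, …, n-4}` together with pendant vertices
`n-3, n-2, n-1` attached to `0, 1, 2` respectively. -/
def ENgraph (n : ℕ) : SimpleGraph (Fin n) :=
  SimpleGraph.fromRel (fun i j =>
    (i.val < n - 3 ∧ j.val < n - 3) ∨ j.val = i.val + (n - 3))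

/-- `EP n`: a clique on `{0,…,n-7}` with `a_i = i`, a triangle `b_i = n-6+i`,
and vertices `c_i = n-3+i` with edges `a_i b_i`, `a_i c_i`, `b_i c_i` (`i = 0,1,2`). -/
def EPgraph (n : ℕ) : SimpleGraph (Fin n) :=
  SimpleGraph.fromRel (fun i j =>
    (i.val < n - 6 ∧ j.val < n - 6) ∨
    (n - 6 ≤ i.val ∧ i.val < n - 3 ∧ n - 6 ≤ j.val ∧ j.val < n - 3) ∨
    (i.val < 3 ∧ (j.val = i.val + (n - 6) ∨ j.val = i.val + (n - 3))) ∨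
    (n - 6 ≤ i.val ∧ i.val < n - 3 ∧ j.val = i.val + 3))

/-- `EP' n`: a clique on `{0,…,n-7}` with `a₁ = 0`, `b₁ = 1`, `c₁ = 2`, triangles
`a₁a₂a₃` and `b₁b₂b₃` where `a₂ = n-6`, `a₃ = n-5`, `b₂ = n-4`, `b₃ = n-3`, and
vertices `c₂ = n-2`, `c₃ = n-1` with edges `a_i b_i`, `a_i c_i`, `b_i c_i` for `i = 2,3`. -/
def EP'graph (n : ℕ) : SimpleGraph (Fin n) :=
  SimpleGraph.fromRel (fun i j =>
    (i.val < n - 6 ∧ j.val < n - 6) ∨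
    (i.val = 0 ∧ (j.val = n - 6 ∨ j.val = n - 5)) ∨
    (i.val = 1 ∧ (j.val = n - 4 ∨ j.val = n - 3)) ∨
    (i.val = n - 6 ∧ (j.val = n - 5 ∨ j.val = n - 4 ∨ j.val = n - 2)) ∨
    (i.val = n - 5 ∧ (j.val = n - 3 ∨ j.val = n - 1)) ∨
    (i.val = n - 4 ∧ (j.val = n - 3 ∨ j.val = n - 2)) ∨
    (i.val = n - 3 ∧ j.val = n - 1))

section

variable {V : Type*}

/-- `IsSeg G a b l`: the list `l` is the vertex sequence of a walk of `G` from `a` to `b`. -/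
inductive IsSeg (G : SimpleGraph V) : V → V → List V → Prop
  | single (a : V) : IsSeg G a a [a]
  | cons {a b c : V} {l : List V} : G.Adj a b → IsSeg G b c l → IsSeg G a c (a :: l)

namespace IsSeg

variable {G : SimpleGraph V} {a b c d : V} {l l' : List V}

lemma append (h : IsSeg G a b l) (hbc : G.Adj b c) (h' : IsSeg G c d l') :
    IsSeg G a d (l ++ l') := by
  induction h with
  | single a => exact cons hbc h'
  | cons h _ ih => exact cons h (ih hbc)

lemma snoc (h : IsSeg G a b l) (hbc : G.Adj b c) : IsSeg G a c (l ++ [c]) :=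
  h.append hbc (single c)

lemma reverse (h : IsSeg G a b l) : IsSeg G b a l.reverse := by
  induction h with
  | single a => exact single a
  | cons h _ ih => simpa using ih.snoc h.symm

lemma exists_cons (h : IsSeg G a b l) : ∃ t, l = a :: t := by
  cases h with
  | single => exact ⟨[], rfl⟩
  | cons => exact ⟨_, rfl⟩

lemma exists_snoc (h : IsSeg G a b l) : ∃ t, l = t ++ [b] := by
  obtain ⟨t, ht⟩ := h.reverse.exists_cons
  exact ⟨t.reverse, by simpa using congrArg List.reverse ht⟩

lemma mem_left (h : IsSeg G a b l) : a ∈ l := by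
  obtain ⟨t, rfl⟩ := h.exists_cons
  simp

lemma mem_right (h : IsSeg G a b l) : b ∈ l := by
  obtain ⟨t, rfl⟩ := h.exists_snoc
  simp

lemma ne_nil (h : IsSeg G a b l) : l ≠ [] := List.ne_nil_of_mem h.mem_left

lemma of_cons_cons {x y : V} (h : IsSeg G a b (x :: y :: l)) :
    a = x ∧ G.Adj x y ∧ IsSeg G y b (y :: l) := by
  cases h with
  | cons h h' =>
    obtain ⟨t, ht⟩ := h'.exists_cons
    obtain ⟨rfl, rfl⟩ := List.cons_eq_cons.mp ht
    exact ⟨rfl, h, h'⟩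

lemma of_singleton {x : V} (h : IsSeg G a b [x]) : a = x ∧ b = x := by
  cases h with
  | single => exact ⟨rfl, rfl⟩
  | cons _ h' => exact absurd rfl h'.ne_nil

lemma split_append (h : IsSeg G a b l) : ∀ {l₁ l₂ : List V}, l = l₁ ++ l₂ → l₁ ≠ [] → l₂ ≠ [] →
    ∃ p q, IsSeg G a p l₁ ∧ G.Adj p q ∧ IsSeg G q b l₂ := by
  induction h with
  | single a =>
    intro l₁ l₂ e h₁ h₂
    have := congrArg List.length e
    have := List.length_pos_iff.mpr h₁
    have := List.length_pos_iff.mpr h₂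
    simp at *
    omega
  | cons hab h ih =>
    intro l₁ l₂ e h₁ h₂
    cases l₁ with
    | nil => exact absurd rfl h₁
    | cons x l₁ =>
      simp only [List.cons_append, List.cons.injEq] at e
      obtain ⟨rfl, e⟩ := e
      by_cases hl : l₁ = []
      · subst hl
        rw [List.nil_append] at e
        exact ⟨_, _, single _, hab, e ▸ h⟩
      · obtain ⟨p, q, hp, hpq, hq⟩ := ih e hl h₂
        exact ⟨p, q, cons hab hp, hpq, hq⟩

lemma split_mem (h : IsSeg G a b l) {x : V} (hx : x ∈ l) (hxa : x ≠ a) (hxb : x ≠ b) :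
    ∃ p q l₁ l₂, l = l₁ ++ ([x] ++ l₂) ∧ IsSeg G a p l₁ ∧ G.Adj p x ∧ G.Adj x q ∧
      IsSeg G q b l₂ := by
  obtain ⟨l₁, l₂, rfl⟩ := List.append_of_mem hx
  have h₁ : l₁ ≠ [] := by
    rintro rfl
    obtain ⟨t, ht⟩ := h.exists_cons
    simp at ht
    exact hxa ht.1
  have h₂ : l₂ ≠ [] := by
    rintro rfl
    obtain ⟨t, ht⟩ := h.exists_snoc
    have := (List.append_inj' ht rfl).2
    simp at this
    exact hxb this
  obtain ⟨p, q, hp, hpq, hq⟩ := h.split_append (l₁ := l₁) (l₂ := x :: l₂) rfl h₁ (by simp)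
  obtain ⟨p', q', hp', hpq', hq'⟩ := hq.split_append (l₁ := [x]) (l₂ := l₂) rfl (by simp) h₂
  obtain ⟨rfl, rfl⟩ := hp'.of_singleton
  exact ⟨p, q', l₁, l₂, rfl, hp, hpq, hpq', hq'⟩

lemma exists_walk (h : IsSeg G a b l) : ∃ p : G.Walk a b, p.support = l := by
  induction h with
  | single a => exact ⟨.nil, rfl⟩
  | cons h _ ih =>
    obtain ⟨p, rfl⟩ := ih
    exact ⟨.cons h p, rfl⟩

lemma of_walk (p : G.Walk a b) : IsSeg G a b p.support := by
  induction p with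
  | nil => exact single _
  | cons h _ ih => exact cons h ih

end IsSeg

/-- A graph has a spanning cycle, recorded as a list of vertices; the degenerate cases of one or
two vertices are not excluded. -/
def HasHamList (G : SimpleGraph V) : Prop :=
  ∃ a b l, IsSeg G a b l ∧ l.Nodup ∧ (∀ v, v ∈ l) ∧ G.Adj b a

lemma HasHamList.isHamiltonian [Fintype V] [DecidableEq V] {G : SimpleGraph V}
    (hV : 3 ≤ Fintype.card V) (h : HasHamList G) : G.IsHamiltonian := by
  obtain ⟨a, b, l, hs, hn, hall, hba⟩ := h
  intro _
  obtain ⟨p, rfl⟩ := hs.exists_walk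
  refine ⟨b, .cons hba p, ?_⟩
  have hp : p.IsPath := (Walk.isPath_def p).mpr hn
  have hH : p.IsHamiltonian := hp.isHamiltonian_of_mem hall
  refine ⟨?_, fun v => by simpa using hH v⟩
  rw [Walk.cons_isCycle_iff]
  refine ⟨hp, fun he => ?_⟩
  have hlen := hH.length_eq
  have h1 : p.length = 1 := by
    rw [Sym2.eq_swap] at he
    exact hp.length_eq_one_of_mem_edges he
  omega

lemma List.Perm.nodup_and_mem {α : Type*} {l l' : List α} (h : l.Perm l')
    (hl : l.Nodup ∧ ∀ v, v ∈ l) : l'.Nodup ∧ ∀ v, v ∈ l' :=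
  ⟨h.nodup_iff.mp hl.1, fun v => h.mem_iff.mp (hl.2 v)⟩

lemma hasHamList_of_perm {G : SimpleGraph V} {a b : V} {l l' : List V} (h : IsSeg G a b l)
    (hba : G.Adj b a) (hl : l'.Nodup ∧ ∀ v, v ∈ l') (hp : l'.Perm l) : HasHamList G :=
  ⟨a, b, l, h, (hp.nodup_and_mem hl).1, (hp.nodup_and_mem hl).2, hba⟩

/-- A walk in `H + uw` is a walk of `H` or uses the edge `uw`. -/
lemma IsSeg.or_split_of_sup_edge {H : SimpleGraph V} {u w a b : V} {l : List V}
    (h : IsSeg (H ⊔ edge u w) a b l) : IsSeg H a b l ∨ ∃ l₁ l₂, l = l₁ ++ l₂ ∧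
      (IsSeg (H ⊔ edge u w) a u l₁ ∧ IsSeg (H ⊔ edge u w) w b l₂ ∨
        IsSeg (H ⊔ edge u w) a w l₁ ∧ IsSeg (H ⊔ edge u w) u b l₂) := by
  induction h with
  | single a => exact .inl (.single a)
  | @cons a b c l hab hs ih =>
    rcases ih with ih | ⟨l₁, l₂, rfl, ih⟩
    · rw [sup_adj, edge_adj] at hab
      rcases hab with hab | ⟨⟨rfl, rfl⟩ | ⟨rfl, rfl⟩, -⟩
      · exact .inl (.cons hab ih)
      · exact .inr ⟨[a], l, rfl, .inl ⟨.single _, hs⟩⟩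
      · exact .inr ⟨[a], l, rfl, .inr ⟨.single _, hs⟩⟩
    · exact .inr ⟨a :: l₁, l₂, rfl, ih.imp (fun h => ⟨.cons hab h.1, h.2⟩)
        (fun h => ⟨.cons hab h.1, h.2⟩)⟩

lemma IsSeg.length_eq_one_of_nodup {G : SimpleGraph V} {a : V} {l : List V} (h : IsSeg G a a l)
    (hn : l.Nodup) : l.length = 1 := by
  cases h with
  | single => rfl
  | cons _ h => exact absurd h.mem_right (List.nodup_cons.mp hn).1

/-- A path of `H + uw` from `u` to `w` with at least three vertices lies in `H`. -/
lemma IsSeg.of_sup_edge {H : SimpleGraph V} {u w : V} {l : List V} (h : IsSeg (H ⊔ edge u w) u w l)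
    (hn : l.Nodup) (hl : 3 ≤ l.length) : IsSeg H u w l := by
  rcases h.or_split_of_sup_edge with h | ⟨l₁, l₂, rfl, ⟨h₁, h₂⟩ | ⟨h₁, h₂⟩⟩
  · exact h
  · have hn' := List.nodup_append.mp hn
    have := h₁.length_eq_one_of_nodup hn'.1
    have := h₂.length_eq_one_of_nodup hn'.2.1
    simp at hl
    omega
  · exact absurd rfl ((List.nodup_append.mp hn).2.2 _ h₁.mem_left _ h₂.mem_left)

lemma HasHamList.of_sup_edge [Fintype V] (hV : 3 ≤ Fintype.card V) {H : SimpleGraph V} {u w : V}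
    (h : HasHamList (H ⊔ edge u w)) :
    HasHamList H ∨ ∃ l, IsSeg H u w l ∧ l.Nodup ∧ ∀ v, v ∈ l := by
  classical
  obtain ⟨a, b, l, hs, hn, hall, hba⟩ := h
  have hlen : 3 ≤ l.length := by
    have hu : l.toFinset = Finset.univ := Finset.eq_univ_iff_forall.mpr (by simpa using hall)
    rw [← List.toFinset_card_of_nodup hn, hu]
    exact hV
  rcases hs.or_split_of_sup_edge with h | ⟨l₁, l₂, rfl, h⟩
  · rw [sup_adj, edge_adj] at hba
    rcases hba with hba | ⟨⟨rfl, rfl⟩ | ⟨rfl, rfl⟩, -⟩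
    · exact .inl ⟨a, b, l, h, hn, hall, hba⟩
    · exact .inr ⟨l.reverse, h.reverse, by simpa, by simpa⟩
    · exact .inr ⟨l, h, hn, hall⟩
  · have hp := (List.perm_append_comm (l₁ := l₁) (l₂ := l₂)).nodup_and_mem ⟨hn, hall⟩
    have hlen' : 3 ≤ (l₂ ++ l₁).length := by simpa [add_comm] using hlen
    rcases h with ⟨h₁, h₂⟩ | ⟨h₁, h₂⟩
    · have := h₂.append hba h₁
      rw [edge_comm] at this
      exact .inr ⟨_, (this.of_sup_edge hp.1 hlen').reverse, List.nodup_reverse.mpr hp.1,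
        fun v => List.mem_reverse.mpr (hp.2 v)⟩
    · exact .inr ⟨_, (h₂.append hba h₁).of_sup_edge hp.1 hlen', hp⟩

end

section

variable {V : Type*}

lemma ClawFree.adj_or {G : SimpleGraph V} (h : ClawFree G) {v a b c : V} (hva : G.Adj v a)
    (hvb : G.Adj v b) (hvc : G.Adj v c) (hab : a ≠ b) (hac : a ≠ c) (hbc : b ≠ c) :
    G.Adj a b ∨ G.Adj a c ∨ G.Adj b c := by
  by_contra! hc
  exact h ⟨v, a, b, c, hab, hac, hbc, hva, hvb, hvc, hc⟩

/-- Rotating a spanning path whose ends are crosswise adjacent to consecutive vertices. -/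
lemma hasHamList_of_crossing {H : SimpleGraph V} {u p q w : V} {A B l : List V}
    (hl : l.Nodup ∧ ∀ v, v ∈ l) (e : l = A ++ B) (hA : IsSeg H u p A) (hB : IsSeg H q w B)
    (hpw : H.Adj p w) (huq : H.Adj u q) : HasHamList H := by
  refine hasHamList_of_perm (hA.append hpw hB.reverse) huq.symm hl ?_
  rw [e]
  exact (List.reverse_perm B).symm.append_left A

/-- Closing up a spanning path between two neighbours `u`, `w` of `x` which have a further
common neighbour `y` in the neighbourhood of `x`, where `y` follows `x` on the path. -/
lemma hasHamList_of_ordered {G H : SimpleGraph V} (hclaw : ClawFree G) {x u w y : V}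
    (hGH : ∀ a b, G.Adj a b → H.Adj a b)
    (hHG : ∀ a b, H.Adj a b → G.Adj a b ∨ (G.Adj x a ∧ G.Adj x b))
    (hu : G.Adj x u) (hw : G.Adj x w) (hy : G.Adj x y) (huw : u ≠ w) (hnuw : ¬ H.Adj u w)
    (hyu : H.Adj y u) (hyw : H.Adj y w) {p r : V} {A T : List V}
    (hA : IsSeg H u p A) (hpx : H.Adj p x) (hxr : H.Adj x r) (hT : IsSeg H r w T)
    (hl : (A ++ ([x] ++ T)).Nodup ∧ ∀ v, v ∈ A ++ ([x] ++ T)) (hyT : y ∈ T) :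
    HasHamList H := by
  classical
  by_contra hno
  have hAx := hA.snoc hpx
  have hru : ¬ H.Adj u r := fun h =>
    hno (hasHamList_of_crossing hl (by simp) hAx hT (hGH _ _ hw) h)
  have hyr : y ≠ r := by
    rintro rfl
    exact hru hyu.symm
  obtain ⟨z, q, M, B, rfl, hM, hzy, hyq, hB⟩ := hT.split_mem hyT hyr hyw.ne
  have hAM := hAx.append hxr hM
  have hqu : ¬ H.Adj u q := fun h =>
    hno (hasHamList_of_crossing hl (by simp) (hAM.snoc hzy) hB hyw h)
  have hzw : ¬ H.Adj z w := fun h =>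
    hno (hasHamList_of_crossing hl (by simp) hAM (.cons hyq hB) h hyu.symm)
  have hGx : ∀ v, H.Adj x v → G.Adj x v := fun v hv =>
    (hHG x v hv).resolve_right fun h => G.irrefl h.1
  have hxr' := hGx r hxr
  have hnd := hl.1
  have hdAM : ∀ s ∈ A, ∀ t ∈ M, s ≠ t := by grind
  have hdMB : ∀ s ∈ M, ∀ t ∈ B, s ≠ t := by grind
  have hdAB : ∀ s ∈ A, ∀ t ∈ B, s ≠ t := by grind
  have hdxM : ∀ t ∈ M, x ≠ t := by grind
  have hdxB : ∀ t ∈ B, x ≠ t := by grind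
  have hrw : H.Adj w r := by
    rcases hclaw.adj_or hu hw hxr' huw (hdAM _ hA.mem_left _ hM.mem_left)
      (hdMB _ hM.mem_left _ hB.mem_right).symm with h | h | h
    · exact absurd (hGH _ _ h) hnuw
    · exact absurd (hGH _ _ h) hru
    · exact hGH _ _ h
  have hzu : ¬ H.Adj z u := by
    intro h
    refine hno (hasHamList_of_perm (((hAx.append (hGH _ _ hy) (.single y)).append hyq
      hB).append hrw hM) h hl ?_)
    rw [List.perm_iff_count]
    intro v
    simp only [List.count_append]
    omega
  have hzx : ¬ G.Adj x z := by
    intro h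
    rcases hclaw.adj_or hu hw h huw (hdAM _ hA.mem_left _ hM.mem_right)
      (hdMB _ hM.mem_right _ hB.mem_right).symm with h | h | h
    · exact hnuw (hGH _ _ h)
    · exact hzu (hGH _ _ h).symm
    · exact hzw (hGH _ _ h).symm
  have hzy' : G.Adj z y := (hHG z y hzy).resolve_right fun h => hzx h.1
  have hxq : G.Adj x q := by
    by_contra hxq
    have hyq' : G.Adj y q := (hHG y q hyq).resolve_right fun h => hxq h.2
    rcases hclaw.adj_or hy.symm hzy'.symm hyq' (hdxM _ hM.mem_right) (hdxB _ hB.mem_left)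
      (hdMB _ hM.mem_right _ hB.mem_left) with h | h | h
    · exact hzx h
    · exact hxq h
    · refine hno (hasHamList_of_perm ((hAM.append (hGH _ _ h) hB).snoc hyw.symm) hyu hl ?_)
      rw [List.perm_iff_count]
      intro v
      simp only [List.count_append]
      omega
  have hrq : H.Adj r q := by
    rcases hclaw.adj_or hu hxr' hxq (hdAM _ hA.mem_left _ hM.mem_left)
      (hdAB _ hA.mem_left _ hB.mem_left) (hdMB _ hM.mem_left _ hB.mem_left) with h | h | h
    · exact absurd (hGH _ _ h) hru
    · exact absurd (hGH _ _ h) hqu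
    · exact hGH _ _ h
  refine hno (hasHamList_of_perm (((((IsSeg.single y).append hzy.symm hM.reverse).append hrq
    hB).append (hGH _ _ hw).symm (.single x)).append hpx.symm hA.reverse) hyu.symm hl ?_)
  rw [List.perm_iff_count]
  intro v
  simp only [List.count_append, List.count_reverse]
  omega

lemma hasHamList_of_common_neighbor {G H : SimpleGraph V} (hclaw : ClawFree G) {x u w y : V}
    (hGH : ∀ a b, G.Adj a b → H.Adj a b)
    (hHG : ∀ a b, H.Adj a b → G.Adj a b ∨ (G.Adj x a ∧ G.Adj x b))
    (hu : G.Adj x u) (hw : G.Adj x w) (hy : G.Adj x y) (huw : u ≠ w) (hnuw : ¬ H.Adj u w)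
    (hyu : H.Adj y u) (hyw : H.Adj y w) {l : List V} (h : IsSeg H u w l)
    (hl : l.Nodup ∧ ∀ v, v ∈ l) : HasHamList H := by
  classical
  obtain ⟨p, r, A, T, rfl, hA, hpx, hxr, hT⟩ := h.split_mem (hl.2 x) hu.ne hw.ne
  have hyl := hl.2 y
  have hyx : y ∉ [x] := by simpa using hy.ne'
  rcases List.mem_append.mp hyl with hyA | hyT
  · refine hasHamList_of_ordered hclaw hGH hHG hw hu hy huw.symm (fun h => hnuw h.symm) hyw hyu
      hT.reverse hxr.symm hpx.symm hA.reverse ?_ (List.mem_reverse.mpr hyA)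
    refine List.Perm.nodup_and_mem ?_ hl
    rw [List.perm_iff_count]
    intro v
    simp only [List.count_append, List.count_reverse]
    omega
  · exact hasHamList_of_ordered hclaw hGH hHG hu hw hy huw hnuw hyu hyw hA hpx hxr hT hl
      ((List.mem_append.mp hyT).resolve_left hyx)

/-- The local completion of `G` at `x`: the neighbourhood of `x` is made complete. -/
def localCompletion (G : SimpleGraph V) (x : V) : SimpleGraph V where
  Adj a b := G.Adj a b ∨ (a ≠ b ∧ G.Adj x a ∧ G.Adj x b)
  symm := ⟨fun _ _ h => h.imp (fun h => h.symm) fun h => ⟨h.1.symm, h.2.2, h.2.1⟩⟩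
  loopless := ⟨fun _ h => h.elim G.irrefl fun h => h.1 rfl⟩

lemma localCompletion_adj {G : SimpleGraph V} {x a b : V} : (localCompletion G x).Adj a b ↔
    G.Adj a b ∨ (a ≠ b ∧ G.Adj x a ∧ G.Adj x b) := Iff.rfl

lemma le_localCompletion (G : SimpleGraph V) (x : V) : G ≤ localCompletion G x :=
  fun _ _ h => .inl h

lemma ClawFree.localCompletion {G : SimpleGraph V} (h : ClawFree G) (x : V) :
    ClawFree (localCompletion G x) := by
  have key : ∀ c p q r : V, p ≠ q → p ≠ r → q ≠ r → G.Adj x c → G.Adj x p →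
      (_root_.localCompletion G x).Adj c q → (_root_.localCompletion G x).Adj c r →
      ¬ (_root_.localCompletion G x).Adj p q → ¬ (_root_.localCompletion G x).Adj p r →
      ¬ (_root_.localCompletion G x).Adj q r → False := by
    intro c p q r hpq hpr hqr hc hp hcq hcr h1 h2 h3
    simp only [localCompletion_adj, not_or, not_and] at *
    have hxq : ¬ G.Adj x q := h1.2 hpq hp
    have hxr : ¬ G.Adj x r := h2.2 hpr hp
    have hcq' : G.Adj c q := hcq.resolve_right fun h => hxq h.2.2
    have hcr' : G.Adj c r := hcr.resolve_right fun h => hxr h.2.2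
    have hx : x ≠ q := by
      rintro rfl
      exact h1.1 hp.symm
    have hx' : x ≠ r := by
      rintro rfl
      exact h2.1 hp.symm
    rcases h.adj_or hc.symm hcq' hcr' hx hx' hqr with h | h | h
    · exact hxq h
    · exact hxr h
    · exact h3.1 h
  rintro ⟨c, p, q, r, hpq, hpr, hqr, h1, h2, h3, n1, n2, n3⟩
  have h1' := h1
  have h2' := h2
  have h3' := h3
  rcases h1 with h1 | ⟨-, hc, hp⟩
  · rcases h2 with h2 | ⟨-, hc, hq⟩
    · rcases h3 with h3 | ⟨-, hc, hr⟩
      · rcases h.adj_or h1 h2 h3 hpq hpr hqr with h | h | h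
        · exact n1 (.inl h)
        · exact n2 (.inl h)
        · exact n3 (.inl h)
      · exact key c r p q hpr.symm hqr.symm hpq hc hr h1' h2' (fun h => n2 h.symm)
          (fun h => n3 h.symm) n1
    · exact key c q p r hpq.symm hqr hpr hc hq h1' h3' (fun h => n1 h.symm) n3 n2
  · exact key c p q r hpq hpr hqr hc hp h2' h3' n1 n2 n3

/-- If the neighbourhood of `x` is connected then completing it does not create Hamiltonicity. -/
lemma hasHamList_of_localCompletion [Fintype V] (hV : 3 ≤ Fintype.card V) {G : SimpleGraph V}
    (hclaw : ClawFree G) {x : V} (hx : (G.induce (G.neighborSet x)).Connected)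
    (h : HasHamList (localCompletion G x)) : HasHamList G := by
  suffices ∀ H : SimpleGraph V, G ≤ H → H ≤ localCompletion G x → HasHamList H from
    this G le_rfl (le_localCompletion G x)
  intro H
  induction H using WellFoundedGT.induction with
  | ind H ih =>
    intro hGH hHG
    by_cases hle : localCompletion G x ≤ H
    · rwa [le_antisymm hle hHG] at h
    have hex : ∃ a b, (localCompletion G x).Adj a b ∧ ¬ H.Adj a b := by
      by_contra! hc
      exact hle fun a b => hc a b
    obtain ⟨a, b, hab, hnab⟩ := hex
    obtain ⟨hne, ha, hb⟩ := hab.resolve_left fun h => hnab (hGH h)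
    obtain ⟨W⟩ := hx.preconnected ⟨a, ha⟩ ⟨b, hb⟩
    obtain ⟨⟨⟨s, t⟩, hst⟩, -, hs, ht⟩ := W.exists_boundary_dart
      {v | v.1 = a ∨ H.Adj a v.1} (.inl rfl) (by simpa [hnab] using hne.symm)
    simp only [Set.mem_ofPred_eq, not_or] at hs ht
    have hst' : G.Adj s.1 t.1 := by simpa using hst
    have has : H.Adj a s.1 := by
      rcases hs with hs | hs
      · exact absurd (hs ▸ hGH hst') ht.2
      · exact hs
    have hH' : H ⊔ edge a t.1 ≤ localCompletion G x := by
      refine sup_le hHG ?_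
      intro v v' h
      rw [edge_adj] at h
      rcases h with ⟨⟨rfl, rfl⟩ | ⟨rfl, rfl⟩, h⟩
      · exact .inr ⟨h, ha, t.2⟩
      · exact .inr ⟨h, t.2, ha⟩
    have hlt : H < H ⊔ edge a t.1 := by
      refine lt_of_le_of_ne le_sup_left fun e => ht.2 ?_
      rw [e, sup_adj, edge_adj]
      exact .inr ⟨.inl ⟨rfl, rfl⟩, Ne.symm ht.1⟩
    rcases (ih _ hlt (hGH.trans le_sup_left) hH').of_sup_edge hV with h' | ⟨l, hl, hl'⟩
    · exact h'
    · exact hasHamList_of_common_neighbor hclaw (fun _ _ h => hGH h)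
        (fun _ _ h => (hHG h).imp id fun h => h.2) ha t.2 s.2 (Ne.symm ht.1) ht.2 has.symm
        (hGH hst') hl hl'

lemma TwoConnected.mono [Fintype V] [DecidableEq V] {G H : SimpleGraph V} (h : TwoConnected G)
    (hle : G ≤ H) : TwoConnected H :=
  ⟨h.1, fun v => (h.2 v).mono fun _ _ hab => hle hab⟩

/-- In a closed claw-free graph, adjacency is transitive on each neighbourhood. -/
lemma ClawFree.adj_trans_of_not_eligible {G : SimpleGraph V} (h : ClawFree G) {x s y z : V}
    (hx : ¬ Eligible G x) (hs : G.Adj x s) (hy : G.Adj x y) (hz : G.Adj x z) (hsy : G.Adj s y)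
    (hyz : G.Adj y z) (hsz : s ≠ z) : G.Adj s z := by
  by_contra hn
  refine hx ⟨?_, s, z, hs, hz, hsz, hn⟩
  have hreach : ∀ t : G.neighborSet x, (G.induce (G.neighborSet x)).Reachable ⟨y, hy⟩ t := by
    rintro ⟨t, ht⟩
    have h1 : (G.induce (G.neighborSet x)).Reachable ⟨y, hy⟩ ⟨s, hs⟩ :=
      Adj.reachable (by simpa using hsy.symm)
    have h2 : (G.induce (G.neighborSet x)).Reachable ⟨y, hy⟩ ⟨z, hz⟩ :=
      Adj.reachable (by simpa using hyz)
    by_cases hts : s = t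
    · subst hts
      exact h1
    by_cases htz : z = t
    · subst htz
      exact h2
    rcases h.adj_or hs hz ht hsz hts htz with h | h | h
    · exact absurd h hn
    · exact h1.trans (Adj.reachable (by simpa using h))
    · exact h2.trans (Adj.reachable (by simpa using h))
  have : Nonempty (G.neighborSet x) := ⟨⟨y, hy⟩⟩
  exact ⟨fun a b => (hreach a).symm.trans (hreach b)⟩

end

section

variable {V : Type*} [Fintype V]

lemma Matrix.IsSymm.finite_eigenvalues [DecidableEq V] (M : Matrix V V ℝ) :
    {μ : ℝ | ∃ x : V → ℝ, x ≠ 0 ∧ M.mulVec x = μ • x}.Finite := by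
  refine (Module.End.finite_hasEigenvalue (Matrix.toLin' M)).subset ?_
  rintro μ ⟨x, hx, h⟩
  refine Module.End.hasEigenvalue_of_hasEigenvector (x := x)
    (Module.End.hasEigenvector_iff.mpr ⟨Module.End.mem_eigenspace_iff.mpr ?_, hx⟩)
  simpa using h

lemma Matrix.IsHermitian.exists_mulVec_eigenvector [DecidableEq V] {M : Matrix V V ℝ}
    (hM : M.IsHermitian) (j : V) :
    ∃ x : V → ℝ, x ≠ 0 ∧ M.mulVec x = hM.eigenvalues j • x := by
  refine ⟨_, ?_, hM.mulVec_eigenvectorBasis j⟩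
  intro h
  apply hM.eigenvectorBasis.orthonormal.ne_zero j
  ext i
  exact congrFun h i

open Classical in
/-- The sum of `x` over the neighbours of `v`. -/
noncomputable def nbrSum (G : SimpleGraph V) (x : V → ℝ) (v : V) : ℝ :=
  ∑ u with G.Adj v u, x u

lemma nbrSum_le_of_le {G H : SimpleGraph V} (hGH : G ≤ H) {x : V → ℝ} (h : ∀ v, 0 ≤ x v) (v : V) :
    nbrSum G x v ≤ nbrSum H x v := by
  classical
  refine Finset.sum_le_sum_of_subset_of_nonneg ?_ fun u _ _ => h u
  intro u hu
  simp only [Finset.mem_filter_univ] at hu ⊢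
  exact hGH hu

lemma le_nbrSum {G : SimpleGraph V} {x : V → ℝ} (h : ∀ v, 0 ≤ x v) {v u : V} (hvu : G.Adj v u) :
    x u ≤ nbrSum G x v := by
  classical
  exact Finset.single_le_sum (f := x) (fun u _ => h u) (by simpa using hvu)

lemma sum_sq_pos {x : V → ℝ} (hx : x ≠ 0) : 0 < ∑ v, x v ^ 2 := by
  obtain ⟨v, hv⟩ := Function.ne_iff.mp hx
  exact Finset.sum_pos' (fun v _ => sq_nonneg _) ⟨v, Finset.mem_univ _, by
    have : x v ≠ 0 := hv
    positivity⟩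

variable [DecidableEq V]

open Classical in
lemma adjSpectralRadius_mem [Nonempty V] (G : SimpleGraph V) :
    (∃ x : V → ℝ, x ≠ 0 ∧ (G.adjMatrix ℝ).mulVec x = adjSpectralRadius G • x) ∧
      ∀ (μ : ℝ) (x : V → ℝ), x ≠ 0 → (G.adjMatrix ℝ).mulVec x = μ • x →
        μ ≤ adjSpectralRadius G := by
  have hfin := Matrix.IsSymm.finite_eigenvalues (G.adjMatrix ℝ)
  have hM : (G.adjMatrix ℝ).IsHermitian := by
    rw [Matrix.IsHermitian, Matrix.conjTranspose_eq_transpose_of_trivial]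
    exact G.isSymm_adjMatrix
  have hne : {μ : ℝ | ∃ x : V → ℝ, x ≠ 0 ∧ (G.adjMatrix ℝ).mulVec x = μ • x}.Nonempty :=
    ⟨_, hM.exists_mulVec_eigenvector (Classical.arbitrary V)⟩
  have hmem := hne.csSup_mem hfin
  have hle : ∀ (μ : ℝ) (x : V → ℝ), x ≠ 0 → (G.adjMatrix ℝ).mulVec x = μ • x →
      μ ≤ sSup {μ : ℝ | ∃ x : V → ℝ, x ≠ 0 ∧ (G.adjMatrix ℝ).mulVec x = μ • x} :=
    fun μ x hx h => le_csSup hfin.bddAbove ⟨x, hx, h⟩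
  exact ⟨hmem, hle⟩

open Classical in
lemma posSemidef_adjSpectralRadius_sub [Nonempty V] (G : SimpleGraph V) :
    (adjSpectralRadius G • (1 : Matrix V V ℝ) - G.adjMatrix ℝ).PosSemidef := by
  have hM : (adjSpectralRadius G • (1 : Matrix V V ℝ) - G.adjMatrix ℝ).IsHermitian := by
    rw [Matrix.IsHermitian, Matrix.conjTranspose_eq_transpose_of_trivial]
    simp [G.isSymm_adjMatrix.eq]
  rw [hM.posSemidef_iff_eigenvalues_nonneg]
  intro j
  obtain ⟨x, hx, h⟩ := hM.exists_mulVec_eigenvector j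
  have := (adjSpectralRadius_mem G).2 (adjSpectralRadius G - hM.eigenvalues j) x hx (by
    rw [Matrix.sub_mulVec, Matrix.smul_mulVec, Matrix.one_mulVec] at h
    rw [sub_smul, ← h]
    abel)
  simpa using this

open Classical in
lemma dotProduct_adjSpectralRadius_sub (G : SimpleGraph V) (c : ℝ) (y : V → ℝ) :
    star y ⬝ᵥ (c • (1 : Matrix V V ℝ) - G.adjMatrix ℝ).mulVec y =
      c * ∑ v, y v ^ 2 - ∑ v, y v * nbrSum G y v := by
  rw [Matrix.sub_mulVec, Matrix.smul_mulVec, Matrix.one_mulVec, dotProduct_sub]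
  congr 1
  · simp only [dotProduct, Finset.mul_sum]
    refine Finset.sum_congr rfl fun v _ => ?_
    simp
    ring
  · simp only [dotProduct, adjMatrix_mulVec_apply, nbrSum]
    refine Finset.sum_congr rfl fun v _ => ?_
    have : G.neighborFinset v = Finset.univ.filter (G.Adj v) := by
      ext
      simp
    rw [← this]
    rfl

lemma rayleigh_le [Nonempty V] (G : SimpleGraph V) (y : V → ℝ) :
    ∑ v, y v * nbrSum G y v ≤ adjSpectralRadius G * ∑ v, y v ^ 2 := by
  classical
  have := (posSemidef_adjSpectralRadius_sub G).dotProduct_mulVec_nonneg y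
  rw [dotProduct_adjSpectralRadius_sub] at this
  linarith

lemma nbrSum_eq_of_rayleigh_ge [Nonempty V] {G : SimpleGraph V} {y : V → ℝ}
    (h : adjSpectralRadius G * ∑ v, y v ^ 2 ≤ ∑ v, y v * nbrSum G y v) (v : V) :
    nbrSum G y v = adjSpectralRadius G * y v := by
  classical
  have h0 := ((posSemidef_adjSpectralRadius_sub G).dotProduct_mulVec_zero_iff y).mp (by
    rw [dotProduct_adjSpectralRadius_sub]
    linarith [rayleigh_le G y])
  have := congrFun h0 v
  rw [Matrix.sub_mulVec, Matrix.smul_mulVec, Matrix.one_mulVec] at this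
  simp only [Pi.sub_apply, Pi.smul_apply, smul_eq_mul, adjMatrix_mulVec_apply,
    Pi.zero_apply] at this
  have hn : G.neighborFinset v = Finset.univ.filter (G.Adj v) := by
    ext
    simp
  rw [nbrSum, ← hn]
  linarith

/-- The spectral radius has a nonnegative eigenvector. -/
lemma exists_nonneg_eigenvector [Nonempty V] (G : SimpleGraph V) :
    ∃ x : V → ℝ, (∀ v, 0 ≤ x v) ∧ x ≠ 0 ∧ ∀ v, nbrSum G x v = adjSpectralRadius G * x v := by
  classical
  obtain ⟨x, hx, h⟩ := (adjSpectralRadius_mem G).1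
  have hx' : ∀ v, nbrSum G x v = adjSpectralRadius G * x v := by
    intro v
    have := congrFun h v
    rw [adjMatrix_mulVec_apply] at this
    have hn : G.neighborFinset v = Finset.univ.filter (G.Adj v) := by
      ext
      simp
    rw [nbrSum, ← hn, this]
    simp
  refine ⟨fun v => |x v|, fun v => abs_nonneg _, ?_, nbrSum_eq_of_rayleigh_ge ?_⟩
  · intro h0
    refine hx (funext fun v => ?_)
    have := congrFun h0 v
    simpa using this
  · rw [Finset.mul_sum]
    refine Finset.sum_le_sum fun v _ => ?_
    calc adjSpectralRadius G * |x v| ^ 2 = x v * nbrSum G x v := by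
          rw [hx', sq_abs]
          ring
      _ ≤ |x v| * |nbrSum G x v| := by
          rw [← abs_mul]
          exact le_abs_self _
      _ ≤ |x v| * nbrSum G (fun v => |x v|) v :=
          mul_le_mul_of_nonneg_left (Finset.abs_sum_le_sum_abs _ _) (abs_nonneg _)

lemma adjSpectralRadius_lt [Nonempty V] {G H : SimpleGraph V} (hlt : G < H) (hH : H.Connected) :
    adjSpectralRadius G < adjSpectralRadius H := by
  by_contra! hle
  obtain ⟨x, hx0, hx, he⟩ := exists_nonneg_eigenvector G
  have hG : ∑ v, x v * nbrSum G x v = adjSpectralRadius G * ∑ v, x v ^ 2 := by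
    rw [Finset.mul_sum]
    refine Finset.sum_congr rfl fun v _ => ?_
    rw [he]
    ring
  have hGH : ∀ v, x v * nbrSum G x v ≤ x v * nbrSum H x v := fun v =>
    mul_le_mul_of_nonneg_left (nbrSum_le_of_le hlt.le hx0 v) (hx0 v)
  have hsq := sum_sq_pos hx
  have hsum : ∑ v, x v * nbrSum G x v ≤ ∑ v, x v * nbrSum H x v :=
    Finset.sum_le_sum fun v _ => hGH v
  have hmul : adjSpectralRadius H * ∑ v, x v ^ 2 ≤ adjSpectralRadius G * ∑ v, x v ^ 2 :=
    mul_le_mul_of_nonneg_right hle hsq.le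
  have heH := nbrSum_eq_of_rayleigh_ge (G := H) (y := x) (by linarith)
  have hpos : ∀ v, 0 < x v := by
    obtain ⟨v₀, hv₀⟩ := Function.ne_iff.mp hx
    have hv₀' : 0 < x v₀ := lt_of_le_of_ne (hx0 _) (Ne.symm hv₀)
    intro v
    by_contra hv
    obtain ⟨W⟩ := hH.preconnected v₀ v
    obtain ⟨⟨⟨s, t⟩, hst⟩, -, hs, ht⟩ := W.exists_boundary_dart {v | 0 < x v} hv₀' hv
    simp only [Set.mem_ofPred_eq] at hs ht hst
    have h1 := le_nbrSum hx0 hst.symm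
    rw [heH] at h1
    have : x t = 0 := le_antisymm (not_lt.mp ht) (hx0 t)
    rw [this] at h1
    linarith
  have hR := rayleigh_le H x
  have hex : ∃ a b, H.Adj a b ∧ ¬ G.Adj a b := by
    by_contra! hc
    exact hlt.not_ge fun a b => hc a b
  obtain ⟨a, b, hab, hnab⟩ := hex
  have hstrict : nbrSum G x a < nbrSum H x a := by
    classical
    refine Finset.sum_lt_sum_of_subset (i := b) ?_ (by simpa using hab) (by simpa using hnab)
      (hpos b) fun u _ _ => hx0 u
    intro u hu
    simp only [Finset.mem_filter_univ] at hu ⊢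
    exact hlt.le hu
  have : ∑ v, x v * nbrSum G x v < ∑ v, x v * nbrSum H x v :=
    Finset.sum_lt_sum (fun v _ => hGH v) ⟨a, Finset.mem_univ _,
      mul_lt_mul_of_pos_left hstrict (hpos a)⟩
  linarith

lemma adjSpectralRadius_le_of_iso {W : Type*} [Fintype W] [DecidableEq W] [Nonempty V]
    [Nonempty W] {G : SimpleGraph V} {H : SimpleGraph W} (e : G ≃g H) :
    adjSpectralRadius G ≤ adjSpectralRadius H := by
  obtain ⟨x, -, hx, he⟩ := exists_nonneg_eigenvector G
  have hsum : ∀ w, nbrSum H (x ∘ e.symm) w = adjSpectralRadius G * x (e.symm w) := by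
    classical
    intro w
    rw [← he]
    refine Finset.sum_equiv e.symm.toEquiv (fun i => ?_) fun i _ => rfl
    simp only [Finset.mem_filter_univ]
    exact e.symm.map_adj_iff.symm
  have hR := rayleigh_le H (x ∘ e.symm)
  have hsq : ∑ w, (x ∘ e.symm) w ^ 2 = ∑ v, x v ^ 2 :=
    Equiv.sum_comp e.symm.toEquiv fun v => x v ^ 2
  have hpos := sum_sq_pos hx
  have hl : ∑ w, (x ∘ e.symm) w * nbrSum H (x ∘ e.symm) w =
      adjSpectralRadius G * ∑ w, (x ∘ e.symm) w ^ 2 := by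
    rw [Finset.mul_sum]
    refine Finset.sum_congr rfl fun w _ => ?_
    rw [hsum]
    simp only [Function.comp_apply]
    ring
  rw [hl, hsq] at hR
  exact le_of_mul_le_mul_right hR hpos

lemma adjSpectralRadius_eq_of_iso {W : Type*} [Fintype W] [DecidableEq W] [Nonempty V]
    [Nonempty W] {G : SimpleGraph V} {H : SimpleGraph W} (e : G ≃g H) :
    adjSpectralRadius G = adjSpectralRadius H :=
  le_antisymm (adjSpectralRadius_le_of_iso e) (adjSpectralRadius_le_of_iso e.symm)

open Classical in
/-- A vertex maximising the nonnegative eigenvector has degree, and number of walks of length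
two, at least as large as the spectral radius predicts. -/
lemma exists_large_degree [Nonempty V] (G : SimpleGraph V) : ∃ v : V,
    adjSpectralRadius G ≤ (Finset.univ.filter (G.Adj v)).card ∧
      adjSpectralRadius G ^ 2 ≤
        ((∑ u with G.Adj v u, (Finset.univ.filter (G.Adj u)).card : ℕ) : ℝ) := by
  obtain ⟨x, hx0, hx, he⟩ := exists_nonneg_eigenvector G
  obtain ⟨v, -, hv⟩ := Finset.exists_max_image Finset.univ x Finset.univ_nonempty
  have hpos : 0 < x v := by
    obtain ⟨w, hw⟩ := Function.ne_iff.mp hx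
    have : 0 < x w := lt_of_le_of_ne (hx0 _) (Ne.symm hw)
    exact this.trans_le (hv w (Finset.mem_univ _))
  have hdeg : ∀ u, nbrSum G x u ≤ (Finset.univ.filter (G.Adj u)).card * x v := by
    intro u
    rw [← nsmul_eq_mul]
    exact Finset.sum_le_card_nsmul _ _ _ fun w _ => hv w (Finset.mem_univ _)
  refine ⟨v, ?_, ?_⟩
  · refine le_of_mul_le_mul_right ?_ hpos
    rw [← he]
    exact hdeg v
  · refine le_of_mul_le_mul_right ?_ hpos
    calc adjSpectralRadius G ^ 2 * x v = adjSpectralRadius G * nbrSum G x v := by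
          rw [he]
          ring
      _ = ∑ u with G.Adj v u, nbrSum G x u := by
          rw [nbrSum, Finset.mul_sum]
          exact Finset.sum_congr rfl fun u _ => (he u).symm
      _ ≤ ∑ u with G.Adj v u, ((Finset.univ.filter (G.Adj u)).card : ℝ) * x v :=
          Finset.sum_le_sum fun u _ => hdeg u
      _ = _ := by
          rw [← Finset.sum_mul]
          push_cast
          rfl

end

section

lemma EPgraph_adj {n : ℕ} {i j : Fin n} : (EPgraph n).Adj i j ↔ i ≠ j ∧
    (((i.val < n - 6 ∧ j.val < n - 6) ∨
    (n - 6 ≤ i.val ∧ i.val < n - 3 ∧ n - 6 ≤ j.val ∧ j.val < n - 3) ∨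
    (i.val < 3 ∧ (j.val = i.val + (n - 6) ∨ j.val = i.val + (n - 3))) ∨
    (n - 6 ≤ i.val ∧ i.val < n - 3 ∧ j.val = i.val + 3)) ∨
    ((j.val < n - 6 ∧ i.val < n - 6) ∨
    (n - 6 ≤ j.val ∧ j.val < n - 3 ∧ n - 6 ≤ i.val ∧ i.val < n - 3) ∨
    (j.val < 3 ∧ (i.val = j.val + (n - 6) ∨ i.val = j.val + (n - 3))) ∨
    (n - 6 ≤ j.val ∧ j.val < n - 3 ∧ i.val = j.val + 3))) := by
  rw [EPgraph, fromRel_adj]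

lemma sum_le_nbrSum {V : Type*} [Fintype V] {G : SimpleGraph V} {x : V → ℝ} (h : ∀ v, 0 ≤ x v)
    {v : V} {T : Finset V} (hT : ∀ u ∈ T, G.Adj v u) : ∑ u ∈ T, x u ≤ nbrSum G x v := by
  classical
  exact Finset.sum_le_sum_of_subset_of_nonneg (fun u hu => by simpa using hT u hu)
    fun u _ _ => h u

/-- A Rayleigh quotient estimate for the spectral radius of `EPgraph`. -/
lemma rayleigh_EPgraph {m : ℕ} (hm : 3 ≤ m) {σ : ℝ} (hσ : 0 ≤ σ) :
    (m : ℝ) ^ 2 - m + 12 * σ + 12 * σ ^ 2 ≤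
      adjSpectralRadius (EPgraph (m + 6)) * (m + 6 * σ ^ 2) := by
  set Y : ℕ → ℝ := fun i => if i < m then 1 else σ with hY
  set g : ℕ → ℝ := fun i => if i < 3 then m - 1 + 2 * σ else if i < m then m - 1 else
    if i < m + 3 then 1 + 3 * σ else 1 + σ with hg
  have hY0 : ∀ i, 0 ≤ Y i := by
    intro i
    simp only [hY]
    split_ifs <;> linarith
  have hrow : ∀ i : Fin (m + 6), g i ≤ nbrSum (EPgraph (m + 6)) (fun j => Y j) i := by
    intro i
    have hK : ∀ i : Fin (m + 6), i.val < m →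
        ∑ j ∈ (Finset.univ.filter fun j : Fin (m + 6) => j.val < m).erase i, Y j =
          (m : ℝ) - 1 := by
      intro i hi
      have hc : (Finset.univ.filter fun j : Fin (m + 6) => j.val < m).card = m := by
        simp [Fin.card_filter_val_lt]
      rw [Finset.sum_congr rfl (g := fun _ => (1 : ℝ))]
      · rw [Finset.sum_const, Finset.card_erase_of_mem (by simpa using hi), hc]
        rw [nsmul_eq_mul, mul_one, Nat.cast_sub (by omega), Nat.cast_one]
      · intro j hj
        simp only [Finset.mem_erase, Finset.mem_filter_univ] at hj
        simp [hY, hj.2]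
    by_cases h3 : i.val < 3
    · have := sum_le_nbrSum (G := EPgraph (m + 6)) (x := fun j => Y j) (fun j => hY0 j) (v := i)
        (T := insert ⟨m + i, by omega⟩ (insert ⟨m + 3 + i, by omega⟩
          ((Finset.univ.filter fun j : Fin (m + 6) => j.val < m).erase i))) (by
          intro u hu
          simp only [Finset.mem_insert, Finset.mem_erase, Finset.mem_filter_univ] at hu
          rw [EPgraph_adj]
          rcases hu with rfl | rfl | hu
          · simp [Fin.ext_iff]
            omega
          · simp [Fin.ext_iff]
            omega
          · refine ⟨Ne.symm hu.1, ?_⟩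
            omega)
      rw [Finset.sum_insert (by simp [Fin.ext_iff]),
        Finset.sum_insert (by simp [Fin.ext_iff]; omega), hK i (by omega)] at this
      have e1 : ¬ m + i.val < m := by omega
      have e2 : ¬ m + 3 + i.val < m := by omega
      simp only [hg, h3, if_true]
      simp only [hY, e1, e2, if_false] at this
      linarith
    by_cases h4 : i.val < m
    · have := sum_le_nbrSum (G := EPgraph (m + 6)) (x := fun j => Y j) (fun j => hY0 j) (v := i)
        (T := (Finset.univ.filter fun j : Fin (m + 6) => j.val < m).erase i) (by
          intro u hu
          simp only [Finset.mem_erase, Finset.mem_filter_univ] at hu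
          rw [EPgraph_adj]
          refine ⟨Ne.symm hu.1, ?_⟩
          omega)
      rw [hK i h4] at this
      simp only [hg, h3, h4, if_true, if_false]
      linarith
    by_cases h5 : i.val < m + 3
    · obtain ⟨t, ht⟩ : ∃ t, i.val = m + t := ⟨i.val - m, by omega⟩
      have := sum_le_nbrSum (G := EPgraph (m + 6)) (x := fun j => Y j) (fun j => hY0 j) (v := i)
        (T := {⟨t, by omega⟩, ⟨m + (t + 1) % 3, by omega⟩, ⟨m + (t + 2) % 3, by omega⟩,
          ⟨m + 3 + t, by omega⟩}) (by
          intro u hu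
          simp only [Finset.mem_insert, Finset.mem_singleton] at hu
          rw [EPgraph_adj, Ne, Fin.ext_iff]
          rcases hu with rfl | rfl | rfl | rfl <;> dsimp only <;> omega)
      rw [Finset.sum_insert (by simp [Fin.ext_iff]; omega),
        Finset.sum_insert (by simp [Fin.ext_iff]; omega),
        Finset.sum_insert (by simp [Fin.ext_iff]; omega), Finset.sum_singleton] at this
      have e1 : t < m := by omega
      have e2 : ¬ m + (t + 1) % 3 < m := by omega
      have e3 : ¬ m + (t + 2) % 3 < m := by omega
      have e4 : ¬ m + 3 + t < m := by omega
      simp only [hg, h3, h4, h5, if_true, if_false]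
      simp only [hY, e1, e2, e3, e4, if_true, if_false] at this
      linarith
    · obtain ⟨t, ht⟩ : ∃ t, i.val = m + 3 + t := ⟨i.val - (m + 3), by omega⟩
      have := sum_le_nbrSum (G := EPgraph (m + 6)) (x := fun j => Y j) (fun j => hY0 j) (v := i)
        (T := {⟨t, by omega⟩, ⟨m + t, by omega⟩}) (by
          intro u hu
          simp only [Finset.mem_insert, Finset.mem_singleton] at hu
          rw [EPgraph_adj, Ne, Fin.ext_iff]
          rcases hu with rfl | rfl <;> dsimp only <;> omega)
      rw [Finset.sum_insert (by simp [Fin.ext_iff]; omega), Finset.sum_singleton] at this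
      have e1 : t < m := by omega
      have e2 : ¬ m + t < m := by omega
      simp only [hg, h3, h4, h5, if_false]
      simp only [hY, e1, e2, if_true, if_false] at this
      linarith
  have hnum : ∑ i : Fin (m + 6), Y i * g i = (m : ℝ) ^ 2 - m + 12 * σ + 12 * σ ^ 2 := by
    obtain ⟨k, rfl⟩ := Nat.exists_eq_add_of_le hm
    rw [Fin.sum_univ_eq_sum_range (fun i => Y i * g i) (3 + k + 6)]
    simp only [Finset.sum_range_succ, Finset.sum_range_add]
    have hk : ∑ x ∈ Finset.range k, Y (3 + x) * g (3 + x) = k * ((3 + k : ℕ) - 1 : ℝ) := by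
      rw [Finset.sum_congr rfl (g := fun _ => ((3 + k : ℕ) - 1 : ℝ)), Finset.sum_const]
      · simp
      · intro x hx
        simp [hY, hg, Finset.mem_range.mp hx]
    rw [hk]
    simp [hY, hg, show 1 < 3 + k by omega, show 2 < 3 + k by omega, show ¬ 3 + k + 1 < 3 by omega,
      show ¬ 3 + k + 2 < 3 by omega, show ¬ 3 + k + 3 < 3 by omega, show ¬ 3 + k + 4 < 3 by omega,
      show ¬ 3 + k + 5 < 3 by omega]
    ring
  have hden : ∑ i : Fin (m + 6), Y i ^ 2 = m + 6 * σ ^ 2 := by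
    rw [Fin.sum_univ_eq_sum_range (fun i => Y i ^ 2) (m + 6)]
    simp only [Finset.sum_range_succ]
    have hk : ∑ x ∈ Finset.range m, Y x ^ 2 = m := by
      rw [Finset.sum_congr rfl (g := fun _ => (1 : ℝ)), Finset.sum_const]
      · simp
      · intro x hx
        simp [hY, Finset.mem_range.mp hx]
    rw [hk]
    simp [hY]
    ring
  have := rayleigh_le (EPgraph (m + 6)) (fun j => Y j)
  rw [hden] at this
  rw [← hnum]
  refine le_trans (Finset.sum_le_sum fun i _ => ?_) this
  exact mul_le_mul_of_nonneg_left (hrow i) (hY0 i)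

lemma le_adjSpectralRadius_EPgraph {m : ℕ} (hm : 27 ≤ m) :
    ((m : ℝ) - 1) ^ 3 * (m - 1) + (6 * (m - 1) + 5) ≤
      adjSpectralRadius (EPgraph (m + 6)) * ((m : ℝ) - 1) ^ 3 := by
  obtain ⟨L, rfl⟩ : ∃ L, m = L + 1 := ⟨m - 1, by omega⟩
  have hL : (26 : ℝ) ≤ L := by exact_mod_cast (by omega : 26 ≤ L)
  have h := rayleigh_EPgraph (m := L + 1) (by omega) (σ := 1 / (L : ℝ)) (by positivity)
  push_cast at h ⊢
  set μ := adjSpectralRadius (EPgraph (L + 1 + 6))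
  have hmul := mul_le_mul_of_nonneg_right h (sq_nonneg (L : ℝ))
  have e1 : (((L : ℝ) + 1) ^ 2 - (L + 1) + 12 * (1 / L) + 12 * (1 / (L : ℝ)) ^ 2) * (L : ℝ) ^ 2 =
      L ^ 3 * (L + 1) + 12 * L + 12 := by
    field_simp
    ring
  have e2 : μ * ((L : ℝ) + 1 + 6 * (1 / (L : ℝ)) ^ 2) * (L : ℝ) ^ 2 =
      μ * (L ^ 2 * (L + 1) + 6) := by
    field_simp
  rw [e1, e2] at hmul
  have hpos : (0 : ℝ) < L ^ 2 * (L + 1) + 6 := by positivity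
  have key : ((L : ℝ) ^ 3 * L + (6 * L + 5)) * (L ^ 2 * (L + 1) + 6) ≤
      μ * L ^ 3 * (L ^ 2 * (L + 1) + 6) := by
    have h3 := mul_le_mul_of_nonneg_right hmul (by positivity : (0 : ℝ) ≤ (L : ℝ) ^ 3)
    nlinarith [mul_nonneg (mul_nonneg (sub_nonneg.mpr hL) (sub_nonneg.mpr hL))
      (sub_nonneg.mpr hL), mul_nonneg (sub_nonneg.mpr hL) (sub_nonneg.mpr hL)]
  have := le_of_mul_le_mul_right key hpos
  simpa using this

end

section

variable {V : Type*} {G : SimpleGraph V}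

/-- A clique whose outside vertices have at most one neighbour in it. -/
structure IsIsolatedClique (G : SimpleGraph V) (K : Finset V) : Prop where
  adj : ∀ a ∈ K, ∀ b ∈ K, a ≠ b → G.Adj a b
  unique : ∀ s ∉ K, ∀ a ∈ K, ∀ b ∈ K, G.Adj s a → G.Adj s b → a = b

/-- Adjacency is transitive on the neighbourhood of each vertex. -/
def LocallyTransitive (G : SimpleGraph V) : Prop := ∀ ⦃x s y z : V⦄, G.Adj x s → G.Adj x y →
  G.Adj x z → G.Adj s y → G.Adj y z → s ≠ z → G.Adj s z

lemma LocallyTransitive.isIsolatedClique (hG : LocallyTransitive G) {K : Finset V}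
    (hK : ∀ a ∈ K, ∀ b ∈ K, a ≠ b → G.Adj a b) (hmax : ∀ s ∉ K, ∃ a ∈ K, ¬ G.Adj s a) :
    IsIsolatedClique G K := by
  refine ⟨hK, fun s hs a ha b hb hsa hsb => ?_⟩
  by_contra hab
  obtain ⟨k, hk, hsk⟩ := hmax s hs
  have hka : k ≠ a := by
    rintro rfl
    exact hsk hsa
  have hkb : k ≠ b := by
    rintro rfl
    exact hsk hsb
  have hks : s ≠ k := by
    rintro rfl
    exact hs hk
  exact hsk (hG hsa.symm (hK a ha b hb hab) (hK a ha k hk hka.symm) hsb (hK b hb k hk hkb.symm)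
    hks)

lemma LocallyTransitive.nbr_cell (hT : LocallyTransitive G) {v a w : V} (ha : G.Adj v a) :
    ∀ u, G.Adj v u → (u = a ∨ G.Adj u a) → G.Adj v w → G.Adj u w → w = a ∨ G.Adj w a := by
  intro u hu hua hw huw
  by_cases hwa : w = a
  · exact .inl hwa
  rcases hua with rfl | hua
  · exact .inr huw.symm
  · exact .inr (hT hw hu ha huw.symm hua hwa)

end

section

variable {V : Type*} [Fintype V] [DecidableEq V] {G : SimpleGraph V}

/-- If the spectral radius is at least that of `EPgraph`, and six vertices lie outside a large
clique `K` each with at most one neighbour in `K`, then each of them has a neighbour in `K`. -/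
lemma exists_adj_of_card_compl_eq_six {K : Finset V}
    (hK : ∀ a ∈ K, ∀ b ∈ K, a ≠ b → G.Adj a b)
    (hK1 : ∀ s ∉ K, ∀ a ∈ K, ∀ b ∈ K, G.Adj s a → G.Adj s b → a = b)
    (hm : 27 ≤ K.card) (hS : Kᶜ.card = 6)
    (hmu : ((K.card : ℝ) - 1) ^ 3 * (K.card - 1) + (6 * (K.card - 1) + 5) ≤
      adjSpectralRadius G * ((K.card : ℝ) - 1) ^ 3) {s₀ : V} (hs₀ : s₀ ∉ K) :
    ∃ a ∈ K, G.Adj s₀ a := by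
  classical
  by_contra! hno
  have : Nonempty V := ⟨s₀⟩
  obtain ⟨x, hx0, hx, he⟩ := exists_nonneg_eigenvector G
  obtain ⟨L, hL⟩ : ∃ L, K.card = L + 1 := ⟨K.card - 1, by omega⟩
  have hL26 : (26 : ℝ) ≤ L := by exact_mod_cast (by omega : 26 ≤ L)
  rw [hL] at hmu
  push_cast at hmu
  rw [add_sub_cancel_right] at hmu
  set μ := adjSpectralRadius G
  have hμ : (L : ℝ) < μ := by
    have hp : (0 : ℝ) < (L : ℝ) ^ 3 := by positivity
    refine lt_of_mul_lt_mul_right (a := (L : ℝ) ^ 3) ?_ hp.le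
    linarith
  have hKne : K.Nonempty := Finset.card_pos.mp (by omega)
  have hSne : Kᶜ.Nonempty := Finset.card_pos.mp (by omega)
  obtain ⟨p, hpK, hp⟩ := Finset.exists_max_image K x hKne
  obtain ⟨s, hsS, hs⟩ := Finset.exists_max_image Kᶜ x hSne
  have hsK : s ∉ K := Finset.mem_compl.mp hsS
  set A : ℝ := ∑ u ∈ K, x u with hA
  have hsplit : ∀ u, nbrSum G x u = (∑ w ∈ K, if G.Adj u w then x w else 0) +
      ∑ w ∈ Kᶜ, if G.Adj u w then x w else 0 := by
    intro u
    rw [nbrSum, Finset.sum_filter, Finset.sum_add_sum_compl]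
  have hinK : ∀ u ∈ K, (∑ w ∈ K, if G.Adj u w then x w else 0) = A - x u := by
    intro u hu
    rw [hA, ← Finset.add_sum_erase K x hu, ← Finset.add_sum_erase K _ hu]
    simp only [G.irrefl, if_false, zero_add, add_sub_cancel_left]
    refine Finset.sum_congr rfl fun w hw => ?_
    rw [if_pos (hK u hu w (Finset.mem_of_mem_erase hw) (Finset.ne_of_mem_erase hw).symm)]
  have hone : ∀ r ∉ K, ∀ y : V → ℝ, (∀ v, 0 ≤ y v) → ∀ c, (∀ u ∈ K, y u ≤ c) → 0 ≤ c →
      (∑ u ∈ K, if G.Adj r u then y u else 0) ≤ c := by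
    intro r hr y hy c hc hc0
    by_cases hex : ∃ a ∈ K, G.Adj r a
    · obtain ⟨a, ha, hra⟩ := hex
      rw [Finset.sum_eq_single_of_mem a ha]
      · rw [if_pos hra]
        exact hc a ha
      · intro b hb hba
        rw [if_neg fun h => hba (hK1 r hr b hb a ha h hra)]
    · push Not at hex
      rw [Finset.sum_eq_zero fun u hu => if_neg (hex u hu)]
      exact hc0
  have hout : ∀ f : V → ℝ, f s₀ = 0 → (∀ r ∈ Kᶜ, f r ≤ x s) → ∑ r ∈ Kᶜ, f r ≤ 5 * x s := by
    intro f hf hfx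
    have h0 : s₀ ∈ Kᶜ := Finset.mem_compl.mpr hs₀
    rw [← Finset.add_sum_erase _ _ h0, hf, zero_add]
    have := Finset.sum_le_card_nsmul (Kᶜ.erase s₀) f (x s)
      fun r hr => hfx r (Finset.mem_of_mem_erase hr)
    rw [Finset.card_erase_of_mem h0, hS] at this
    simpa using this
  have hO : (μ - L) * A ≤ 5 * x s := by
    have h1 : μ * A = ∑ u ∈ K, nbrSum G x u := by
      rw [hA, Finset.mul_sum]
      exact Finset.sum_congr rfl fun u _ => (he u).symm
    have h2 : ∑ u ∈ K, nbrSum G x u =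
        L * A + ∑ u ∈ K, ∑ w ∈ Kᶜ, if G.Adj u w then x w else 0 := by
      rw [Finset.sum_congr rfl (g := fun u => (A - x u) +
        ∑ w ∈ Kᶜ, if G.Adj u w then x w else 0)
        fun u hu => by rw [hsplit, hinK u hu]]
      rw [Finset.sum_add_distrib, Finset.sum_sub_distrib, ← hA, Finset.sum_const, hL,
        nsmul_eq_mul]
      push_cast
      ring
    have h3 : ∑ u ∈ K, ∑ w ∈ Kᶜ, (if G.Adj u w then x w else 0) ≤ 5 * x s := by
      rw [Finset.sum_comm]
      refine hout _ (Finset.sum_eq_zero fun u hu => if_neg fun h => hno u hu h.symm) ?_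
      intro r hr
      refine le_trans ?_ (hs r hr)
      have := hone r (Finset.mem_compl.mp hr) (fun _ => x r) (fun _ => hx0 r) (x r)
        (fun _ _ => le_rfl) (hx0 r)
      simpa only [G.adj_comm] using this
    linarith
  have hs' : (μ - 5) * x s ≤ x p := by
    have h1 := he s
    rw [hsplit] at h1
    have h2 := hone s hsK x hx0 (x p) hp (hx0 p)
    have h3 : (∑ w ∈ Kᶜ, if G.Adj s w then x w else 0) ≤ 5 * x s := by
      rw [← Finset.add_sum_erase _ _ hsS, if_neg G.irrefl, zero_add]
      have := Finset.sum_le_card_nsmul (Kᶜ.erase s) (fun w => if G.Adj s w then x w else 0) (x s)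
        fun r hr => by
          split_ifs
          · exact hs r (Finset.mem_of_mem_erase hr)
          · exact hx0 s
      rw [Finset.card_erase_of_mem hsS, hS] at this
      simpa using this
    linarith
  have hp' : (μ + 1) * x p ≤ A + 5 * x s := by
    have h1 := he p
    rw [hsplit, hinK p hpK] at h1
    have h3 : (∑ w ∈ Kᶜ, if G.Adj p w then x w else 0) ≤ 5 * x s := by
      refine hout _ (if_neg fun h => hno p hpK h.symm) fun r hr => ?_
      split_ifs
      · exact hs r hr
      · exact hx0 s
    linarith
  have hA0 : 0 ≤ A := Finset.sum_nonneg fun u _ => hx0 u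
  have hspos : 0 < x s := by
    refine lt_of_le_of_ne (hx0 s) fun h0 => hx (funext fun v => ?_)
    rw [← h0] at hO hs
    have hAz : A = 0 := by
      have : (μ - L) * A ≤ (μ - L) * 0 := by linarith
      exact le_antisymm (le_of_mul_le_mul_left this (sub_pos.mpr hμ)) hA0
    by_cases hv : v ∈ K
    · exact (Finset.sum_eq_zero_iff_of_nonneg fun u _ => hx0 u).mp hAz v hv
    · exact le_antisymm (hs v (Finset.mem_compl.mpr hv)) (hx0 v)
  have h1 : ((μ + 1) * (μ - 5) - 5) * x s ≤ A := by nlinarith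
  have h2 : ((μ - L) * ((μ + 1) * (μ - 5) - 5)) * x s ≤ 5 * x s := by
    refine le_trans ?_ hO
    rw [mul_assoc]
    exact mul_le_mul_of_nonneg_left h1 (sub_pos.mpr hμ).le
  have h3 := le_of_mul_le_mul_right h2 hspos
  have h4 : ((L : ℝ) + 1) * (L - 5) - 5 ≤ (μ + 1) * (μ - 5) - 5 := by nlinarith
  have h5 : (μ - L) * (((L : ℝ) + 1) * (L - 5) - 5) ≤ 5 :=
    (mul_le_mul_of_nonneg_left h4 (sub_pos.mpr hμ).le).trans h3
  have h6 : (0 : ℝ) ≤ ((L : ℝ) + 1) * (L - 5) - 5 := by nlinarith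
  have h7 : (6 * (L : ℝ) + 5) * (((L : ℝ) + 1) * (L - 5) - 5) ≤ 5 * (L : ℝ) ^ 3 := by
    have h8 := mul_le_mul_of_nonneg_right h5 (by positivity : (0 : ℝ) ≤ (L : ℝ) ^ 3)
    have h9 : 6 * (L : ℝ) + 5 ≤ (μ - L) * (L : ℝ) ^ 3 := by linarith
    have := mul_le_mul_of_nonneg_right h9 h6
    linarith
  nlinarith [mul_nonneg (mul_nonneg (sub_nonneg.mpr hL26) (sub_nonneg.mpr hL26))
      (sub_nonneg.mpr hL26), mul_nonneg (sub_nonneg.mpr hL26) (sub_nonneg.mpr hL26)]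

open Classical in
lemma IsIsolatedClique.sum_degree_le {K : Finset V} (hK : IsIsolatedClique G K) {v : V}
    {A R : Finset V} (hKA : K = insert v A) (hvA : v ∉ A)
    (hAR : ∀ u ∈ A, ∀ w, G.Adj u w → w ∈ K ∨ w ∈ R) (hKR : ∀ r ∈ R, r ∉ K) :
    ∑ u ∈ A, (Finset.univ.filter (G.Adj u)).card ≤ A.card ^ 2 + R.card := by
  have hdeg : ∀ u ∈ A, (Finset.univ.filter (G.Adj u)).card ≤
      A.card + (R.filter (G.Adj u)).card := by
    intro u hu
    have hsub : Finset.univ.filter (G.Adj u) ⊆ K.erase u ∪ R.filter (G.Adj u) := by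
      intro w hw
      simp only [Finset.mem_filter_univ] at hw
      simp only [Finset.mem_union, Finset.mem_erase, Finset.mem_filter]
      rcases hAR u hu w hw with h | h
      · exact .inl ⟨hw.ne', h⟩
      · exact .inr ⟨h, hw⟩
    refine (Finset.card_le_card hsub).trans ((Finset.card_union_le _ _).trans ?_)
    have huK : u ∈ K := by simp [hKA, hu]
    rw [Finset.card_erase_of_mem huK, hKA, Finset.card_insert_of_notMem hvA]
    simp
  refine (Finset.sum_le_sum hdeg).trans ?_
  rw [Finset.sum_add_distrib, Finset.sum_const, smul_eq_mul, sq]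
  refine Nat.add_le_add_left ?_ _
  have hswap : ∑ u ∈ A, (R.filter (G.Adj u)).card =
      ∑ r ∈ R, (A.filter fun u => G.Adj u r).card :=
    Finset.sum_card_bipartiteAbove_eq_sum_card_bipartiteBelow G.Adj
  rw [hswap, Finset.card_eq_sum_ones]
  refine Finset.sum_le_sum fun r hr => Finset.card_le_one.mpr fun a ha b hb => ?_
  simp only [Finset.mem_filter] at ha hb
  exact hK.unique r (hKR r hr) a (by simp [hKA, ha.1]) b (by simp [hKA, hb.1]) ha.2.symm hb.2.symm

open Classical in
lemma LocallyTransitive.isIsolatedClique_cell (hT : LocallyTransitive G) {v a b : V}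
    (ha : G.Adj v a) (hb : G.Adj v b) (hab : a ≠ b) (hnab : ¬ G.Adj a b) :
    IsIsolatedClique G (insert v (Finset.univ.filter fun u => G.Adj v u ∧ (u = a ∨ G.Adj u a))) := by
  refine hT.isIsolatedClique ?_ ?_
  · intro s hs t ht hst
    simp only [Finset.mem_insert, Finset.mem_filter_univ] at hs ht
    rcases hs with rfl | ⟨hs, hsa⟩
    · exact (ht.resolve_left hst.symm).1
    rcases ht with rfl | ⟨ht, hta⟩
    · exact hs.symm
    rcases hsa with rfl | hsa
    · exact (hta.resolve_left hst.symm).symm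
    rcases hta with rfl | hta
    · exact hsa
    exact hT hs ha ht hsa hta.symm hst
  · intro s hs
    by_contra! hc
    refine hs (Finset.mem_insert_of_mem ?_)
    rw [Finset.mem_filter_univ]
    exact ⟨(hc v (Finset.mem_insert_self _ _)).symm, .inr (hc a (by simp [ha]))⟩

open Classical in
lemma exists_large_isIsolatedClique (hclaw : ClawFree G) (hT : LocallyTransitive G) {m : ℕ}
    (hm : 27 ≤ m) (hV : Fintype.card V = m + 6) (hmu : (m : ℝ) - 1 < adjSpectralRadius G) :
    ∃ K : Finset V, IsIsolatedClique G K ∧ m ≤ K.card := by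
  have : Nonempty V := Fintype.card_pos_iff.mp (by omega)
  obtain ⟨v, hdeg, hwalk⟩ := exists_large_degree G
  have hdeg' : m ≤ (Finset.univ.filter (G.Adj v)).card := by
    have h1 : ((m : ℝ) - 1) < ((Finset.univ.filter (G.Adj v)).card : ℝ) := hmu.trans_le hdeg
    have h2 : (m : ℝ) < ((Finset.univ.filter (G.Adj v)).card + 1 : ℕ) := by
      push_cast
      linarith
    have := Nat.cast_lt.mp h2
    omega
  by_cases hc : ∀ a b, G.Adj v a → G.Adj v b → a ≠ b → G.Adj a b
  · refine ⟨insert v (Finset.univ.filter (G.Adj v)), hT.isIsolatedClique ?_ ?_,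
      hdeg'.trans (Finset.card_le_card (Finset.subset_insert _ _))⟩
    · intro a ha b hb hab
      simp only [Finset.mem_insert, Finset.mem_filter_univ] at ha hb
      rcases ha with rfl | ha
      · exact hb.resolve_left hab.symm
      rcases hb with rfl | hb
      · exact ha.symm
      exact hc a b ha hb hab
    · intro s hs
      refine ⟨v, Finset.mem_insert_self _ _, fun h => hs ?_⟩
      simp [h.symm]
  push Not at hc
  obtain ⟨a₀, b₀, ha₀, hb₀, hab, hnab⟩ := hc
  obtain ⟨A, hA⟩ : ∃ A, A = Finset.univ.filter fun u => G.Adj v u ∧ (u = a₀ ∨ G.Adj u a₀) :=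
    ⟨_, rfl⟩
  obtain ⟨B, hB⟩ : ∃ B, B = Finset.univ.filter fun u => G.Adj v u ∧ (u = b₀ ∨ G.Adj u b₀) :=
    ⟨_, rfl⟩
  have hAK := hT.isIsolatedClique_cell ha₀ hb₀ hab hnab
  have hBK := hT.isIsolatedClique_cell hb₀ ha₀ hab.symm fun h => hnab h.symm
  rw [← hA] at hAK
  rw [← hB] at hBK
  have memA : ∀ u, u ∈ A ↔ G.Adj v u ∧ (u = a₀ ∨ G.Adj u a₀) := by simp [hA]
  have memB : ∀ u, u ∈ B ↔ G.Adj v u ∧ (u = b₀ ∨ G.Adj u b₀) := by simp [hB]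
  have hcov : Finset.univ.filter (G.Adj v) = A ∪ B := by
    ext u
    simp only [Finset.mem_filter_univ, Finset.mem_union, memA, memB, ← and_or_left]
    refine ⟨fun h => ⟨h, ?_⟩, fun h => h.1⟩
    by_contra! hc
    rcases hclaw.adj_or h ha₀ hb₀ hc.1.1 hc.2.1 hab with h' | h' | h'
    · exact hc.1.2 h'
    · exact hc.2.2 h'
    · exact hnab h'
  have hAb : ∀ u ∈ A, ¬ (u = b₀ ∨ G.Adj u b₀) := by
    intro u hu h
    rw [memA] at hu
    have hb : b₀ = a₀ ∨ G.Adj b₀ a₀ := by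
      rcases h with rfl | h
      · exact hu.2
      · exact hT.nbr_cell ha₀ u hu.1 hu.2 hb₀ h
    exact hb.elim hab.symm fun h => hnab h.symm
  have hdisj : Disjoint A B := Finset.disjoint_left.mpr fun u hu hu' =>
    hAb u hu ((memB u).mp hu').2
  have hvA : v ∉ A := fun h => G.irrefl ((memA v).mp h).1
  have hvB : v ∉ B := fun h => G.irrefl ((memB v).mp h).1
  set R := (insert v (A ∪ B))ᶜ with hR
  have hcard : A.card + B.card + R.card = m + 5 := by
    rw [hR, Finset.card_compl, Finset.card_insert_of_notMem (by simp [hvA, hvB]),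
      Finset.card_union_of_disjoint hdisj, hV]
    have : A.card + B.card + 1 ≤ m + 6 := by
      rw [← hV, ← Finset.card_union_of_disjoint hdisj,
        ← Finset.card_insert_of_notMem (a := v) (by simp [hvA, hvB])]
      exact Finset.card_le_univ _
    omega
  rw [hcov, Finset.card_union_of_disjoint hdisj] at hdeg'
  have hsA := hAK.sum_degree_le rfl hvA (R := R) (by
    intro u hu w huw
    simp only [hR, Finset.mem_insert, Finset.mem_compl, Finset.mem_union]
    by_cases hwB : w ∈ B
    · rw [memA] at hu
      rw [memB] at hwB
      exact .inl (.inr ((memA w).mpr ⟨hwB.1, hT.nbr_cell ha₀ u hu.1 hu.2 hwB.1 huw⟩))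
    · tauto) (by
    intro r hr
    simp only [hR, Finset.mem_insert, Finset.mem_compl, Finset.mem_union] at hr ⊢
    tauto)
  have hsB := hBK.sum_degree_le rfl hvB (R := R) (by
    intro u hu w huw
    simp only [hR, Finset.mem_insert, Finset.mem_compl, Finset.mem_union]
    by_cases hwA : w ∈ A
    · rw [memB] at hu
      rw [memA] at hwA
      exact .inl (.inr ((memB w).mpr ⟨hwA.1, hT.nbr_cell hb₀ u hu.1 hu.2 hwA.1 huw⟩))
    · tauto) (by
    intro r hr
    simp only [hR, Finset.mem_insert, Finset.mem_compl, Finset.mem_union] at hr ⊢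
    tauto)
  rw [hcov, Finset.sum_union hdisj] at hwalk
  have hsq : ((m : ℝ) - 1) ^ 2 < ((A.card ^ 2 + R.card + (B.card ^ 2 + R.card) : ℕ) : ℝ) := by
    have h1 : (0 : ℝ) ≤ (m : ℝ) - 1 := by
      have : (27 : ℝ) ≤ m := by exact_mod_cast hm
      linarith
    calc ((m : ℝ) - 1) ^ 2 < adjSpectralRadius G ^ 2 := by gcongr
      _ ≤ _ := hwalk
      _ ≤ _ := by exact_mod_cast Nat.add_le_add hsA hsB
  have hsqZ : ((m : ℤ) - 1) ^ 2 < (A.card : ℤ) ^ 2 + R.card + ((B.card : ℤ) ^ 2 + R.card) := by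
    exact_mod_cast hsq
  have hsum : (A.card : ℤ) = m + 5 - R.card - B.card := by omega
  have hr : R.card ≤ 5 := by omega
  have key : ¬ (7 ≤ B.card + R.card ∧ 7 ≤ A.card + R.card) := by
    rintro ⟨h7, h7'⟩
    have h1 : (0 : ℤ) ≤ ((B.card : ℤ) - (7 - R.card)) * ((A.card : ℤ) - (7 - R.card)) :=
      mul_nonneg (by omega) (by omega)
    have h2 : (R.card : ℤ) * (R.card - 12) ≤ 0 :=
      mul_nonpos_of_nonneg_of_nonpos (by omega) (by omega)
    have hm' : (27 : ℤ) ≤ m := by exact_mod_cast hm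
    have hBe : (B.card : ℤ) = m + 5 - R.card - A.card := by omega
    rw [hBe] at hsqZ h1
    nlinarith
  have hcases : B.card + R.card ≤ 6 ∨ A.card + R.card ≤ 6 := by omega
  rcases hcases with h | h
  · refine ⟨_, hAK, ?_⟩
    rw [Finset.card_insert_of_notMem hvA]
    omega
  · refine ⟨_, hBK, ?_⟩
    rw [Finset.card_insert_of_notMem hvB]
    omega

end

section

variable {V : Type*} {G : SimpleGraph V} {a b c d x y : V} {l : List V}

lemma IsSeg.ends_unique (h : IsSeg G a b l) (h' : IsSeg G c d l) : a = c ∧ b = d := by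
  obtain ⟨t, ht⟩ := h.exists_cons
  obtain ⟨t', ht'⟩ := h'.exists_cons
  obtain ⟨s, hs⟩ := h.exists_snoc
  obtain ⟨s', hs'⟩ := h'.exists_snoc
  rw [ht, List.cons.injEq] at ht'
  rw [hs] at hs'
  exact ⟨ht'.1, by simpa using (List.append_inj' hs' rfl).2⟩

lemma IsSeg.exists_nodup [DecidableEq V] (h : IsSeg G a b l) :
    ∃ l', IsSeg G a b l' ∧ l'.Nodup ∧ ∀ v ∈ l', v ∈ l := by
  obtain ⟨p, rfl⟩ := h.exists_walk
  exact ⟨_, .of_walk p.bypass, p.bypass_isPath.support_nodup, fun v hv =>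
    p.support_bypass_subset_support hv⟩

lemma IsSeg.trans {l' : List V} (h : IsSeg G a b l) (h' : IsSeg G b c l') :
    ∃ l'', IsSeg G a c l'' ∧ ∀ v ∈ l'', v ∈ l ∨ v ∈ l' := by
  obtain ⟨p, rfl⟩ := h.exists_walk
  obtain ⟨q, rfl⟩ := h'.exists_walk
  exact ⟨_, .of_walk (p.append q), fun v hv => (Walk.mem_support_append_iff p q).mp hv⟩

variable {K : Finset V}

/-- Disjoint paths with ends in a clique can be concatenated. -/
lemma isSeg_flatten (hK : ∀ a ∈ K, ∀ b ∈ K, a ≠ b → G.Adj a b) {Ls : List (List V)}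
    (hne : Ls ≠ []) (hL : ∀ l ∈ Ls, ∃ x y, x ∈ K ∧ y ∈ K ∧ IsSeg G x y l)
    (hn : Ls.flatten.Nodup) : ∃ x y, x ∈ K ∧ y ∈ K ∧ IsSeg G x y Ls.flatten := by
  induction Ls with
  | nil => exact absurd rfl hne
  | cons L Ls ih =>
    obtain ⟨x, y, hx, hy, hs⟩ := hL L (by simp)
    by_cases he : Ls = []
    · subst he
      exact ⟨x, y, hx, hy, by simpa using hs⟩
    · rw [List.flatten_cons] at hn ⊢
      obtain ⟨x', y', hx', hy', hs'⟩ := ih he (fun l hl => hL l (by simp [hl]))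
        (List.nodup_append.mp hn).2.1
      exact ⟨x, y', hx, hy', hs.append (hK _ hy _ hx'
        ((List.nodup_append.mp hn).2.2 _ hs.mem_right _ hs'.mem_left)) hs'⟩

/-- Two neighbours outside an isolated clique of the same vertex of the clique are adjacent. -/
lemma IsIsolatedClique.adj_of_common (hclaw : ClawFree G) (hK : IsIsolatedClique G K)
    (h2 : 2 ≤ K.card) {k s t : V} (hk : k ∈ K) (hs : s ∉ K) (ht : t ∉ K) (hks : G.Adj k s)
    (hkt : G.Adj k t) (hst : s ≠ t) : G.Adj s t := by
  obtain ⟨k', hk', hne⟩ := Finset.exists_mem_ne (s := K) (by omega) k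
  have hs' : s ≠ k' := by
    rintro rfl
    exact hs hk'
  have ht' : t ≠ k' := by
    rintro rfl
    exact ht hk'
  rcases hclaw.adj_or hks hkt (hK.adj k hk k' hk' hne.symm) hst hs' ht' with h | h | h
  · exact h
  · exact absurd (hK.unique s hs k' hk' k hk h hks.symm) hne
  · exact absurd (hK.unique t ht k' hk' k hk h hkt.symm) hne

variable [DecidableEq V]

/-- The number of entries of a list which lie in `K`. -/
def inCount (K : Finset V) (l : List V) : ℕ := l.countP (fun v => decide (v ∈ K))

/-- The number of entries of a list which lie outside `K`. -/
def outCount (K : Finset V) (l : List V) : ℕ := l.countP (fun v => decide (v ∉ K))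

@[simp] lemma inCount_nil : inCount K [] = 0 := rfl

@[simp] lemma outCount_nil : outCount K [] = 0 := rfl

@[simp] lemma inCount_cons : inCount K (a :: l) = inCount K l + if a ∈ K then 1 else 0 := by
  simp [inCount, List.countP_cons]

@[simp] lemma outCount_cons : outCount K (a :: l) = outCount K l + if a ∈ K then 0 else 1 := by
  by_cases h : a ∈ K <;> simp [outCount, h]

@[simp] lemma inCount_append {l' : List V} : inCount K (l ++ l') = inCount K l + inCount K l' := by
  simp [inCount]

@[simp] lemma outCount_append {l' : List V} :
    outCount K (l ++ l') = outCount K l + outCount K l' := by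
  simp [outCount]

lemma List.Perm.inCount_eq {l' : List V} (h : l.Perm l') : inCount K l = inCount K l' :=
  h.countP_eq _

lemma List.Perm.outCount_eq {l' : List V} (h : l.Perm l') : outCount K l = outCount K l' :=
  h.countP_eq _

lemma inCount_eq_zero : inCount K l = 0 ↔ ∀ v ∈ l, v ∉ K := by
  simp [inCount]

lemma outCount_eq_length (h : ∀ v ∈ l, v ∉ K) : outCount K l = l.length := by
  rw [outCount, List.countP_eq_length]
  simpa using h

lemma outCount_le [Fintype V] (h : l.Nodup) : outCount K l ≤ Kᶜ.card := by
  rw [outCount, List.countP_eq_length_filter, ← List.toFinset_card_of_nodup (h.filter _)]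
  refine Finset.card_le_card fun v hv => ?_
  simpa using (List.mem_filter.mp (List.mem_toFinset.mp hv)).2

/-- A path with both ends in `K` whose other vertices, of which there is at least one, are
outside `K`. -/
structure IsLink (G : SimpleGraph V) (K : Finset V) (l : List V) : Prop where
  ends : ∃ x y, x ∈ K ∧ y ∈ K ∧ IsSeg G x y l
  count : inCount K l = 2
  outCount_pos : 1 ≤ outCount K l

/-- A list of pairwise disjoint links. -/
structure IsLinkSystem (G : SimpleGraph V) (K : Finset V) (Ls : List (List V)) : Prop where
  link : ∀ l ∈ Ls, IsLink G K l
  nodup : Ls.flatten.Nodup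

lemma IsLink.reverse (h : IsLink G K l) : IsLink G K l.reverse := by
  obtain ⟨⟨x, y, hx, hy, hs⟩, hc, ho⟩ := h
  exact ⟨⟨y, x, hy, hx, hs.reverse⟩, by rw [(List.reverse_perm l).inCount_eq, hc],
    by rwa [(List.reverse_perm l).outCount_eq]⟩

/-- A system of links covering all vertices outside a clique closes up to a spanning cycle. -/
lemma IsLinkSystem.hasHamList [Fintype V] (hV : 3 ≤ Fintype.card V)
    (hK : ∀ a ∈ K, ∀ b ∈ K, a ≠ b → G.Adj a b) {Ls : List (List V)} (h : IsLinkSystem G K Ls)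
    (hcov : ∀ v ∉ K, v ∈ Ls.flatten) : HasHamList G := by
  set R := (Finset.univ.filter fun v => v ∉ Ls.flatten).toList with hR
  have hmemR : ∀ v, v ∈ R ↔ v ∉ Ls.flatten := by
    intro v
    rw [hR, Finset.mem_toList, Finset.mem_filter_univ]
  have hflat : (Ls ++ R.map fun k => [k]).flatten = Ls.flatten ++ R := by
    rw [List.flatten_append]
    congr 1
    generalize R = R'
    induction R' with
    | nil => rfl
    | cons a R ih => simpa using ih
  have hn : (Ls.flatten ++ R).Nodup := by
    rw [List.nodup_append]
    refine ⟨h.nodup, Finset.nodup_toList _, ?_⟩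
    rintro v hv w hw rfl
    exact (hmemR v).mp hw hv
  have hall : ∀ v, v ∈ Ls.flatten ++ R := by
    intro v
    rw [List.mem_append, hmemR]
    exact em _
  have hlen : 3 ≤ (Ls.flatten ++ R).length := by
    rw [← List.toFinset_card_of_nodup hn,
      show (Ls.flatten ++ R).toFinset = Finset.univ from
        Finset.eq_univ_iff_forall.mpr fun v => List.mem_toFinset.mpr (hall v)]
    exact hV
  obtain ⟨x, y, hx, hy, hs⟩ := isSeg_flatten (G := G) hK (Ls := Ls ++ R.map fun k => [k]) (by
      intro he
      rw [he] at hflat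
      rw [← hflat] at hlen
      simp at hlen) (by
      intro l hl
      rcases List.mem_append.mp hl with hl | hl
      · exact (h.link l hl).ends
      · obtain ⟨k, hk, rfl⟩ := List.mem_map.mp hl
        have hkK : k ∈ K := by
          by_contra hkK
          exact (hmemR k).mp hk (hcov k hkK)
        exact ⟨k, k, hkK, hkK, .single k⟩) (by rwa [hflat])
  rw [hflat] at hs
  refine ⟨x, y, _, hs, hn, hall, hK y hy x hx ?_⟩
  rintro rfl
  have := hs.length_eq_one_of_nodup hn
  omega

/-- If `G` has no spanning cycle there is a link system covering a maximum number of vertices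
outside `K`, and it misses one. -/
lemma exists_max_linkSystem [Fintype V] (hV : 3 ≤ Fintype.card V)
    (hK : ∀ a ∈ K, ∀ b ∈ K, a ≠ b → G.Adj a b) (hno : ¬ HasHamList G) :
    ∃ Ls, IsLinkSystem G K Ls ∧
      (∀ Ls', IsLinkSystem G K Ls' → outCount K Ls'.flatten ≤ outCount K Ls.flatten) ∧
      ∃ d ∉ K, d ∉ Ls.flatten := by
  have hbdd : BddAbove {k | ∃ Ls, IsLinkSystem G K Ls ∧ outCount K Ls.flatten = k} := by
    refine ⟨Kᶜ.card, ?_⟩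
    rintro _ ⟨Ls, h, rfl⟩
    exact outCount_le h.nodup
  have hne : {k | ∃ Ls, IsLinkSystem G K Ls ∧ outCount K Ls.flatten = k}.Nonempty :=
    ⟨_, [], ⟨by simp, by simp⟩, rfl⟩
  obtain ⟨Ls, h, he⟩ := Nat.sSup_mem hne hbdd
  refine ⟨Ls, h, fun Ls' h' => he ▸ le_csSup hbdd ⟨Ls', h', rfl⟩, ?_⟩
  by_contra! hc
  exact hno (h.hasHamList hV hK hc)

/-- A link which cannot be replaced by a longer one on its own vertices and free vertices. -/
structure IsTightLink (G : SimpleGraph V) (K : Finset V) (Free : V → Prop) (W : List V) :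
    Prop extends IsLink G K W where
  nodup : W.Nodup
  not_free : ∀ v ∈ W, ¬ Free v
  le : ∀ N, IsLink G K N → N.Nodup → (∀ v ∈ N, v ∈ W ∨ Free v) → outCount K N ≤ outCount K W

lemma IsTightLink.reverse {Free : V → Prop} (h : IsTightLink G K Free l) :
    IsTightLink G K Free l.reverse where
  toIsLink := h.toIsLink.reverse
  nodup := List.nodup_reverse.mpr h.nodup
  not_free v hv := h.not_free v (List.mem_reverse.mp hv)
  le N hN hn hv := by
    rw [(List.reverse_perm l).outCount_eq]
    exact h.le N hN hn fun v hvN => by simpa using hv v hvN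

lemma IsLinkSystem.isTightLink {Ls : List (List V)} (h : IsLinkSystem G K Ls)
    (hmax : ∀ Ls', IsLinkSystem G K Ls' → outCount K Ls'.flatten ≤ outCount K Ls.flatten)
    {W : List V} (hW : W ∈ Ls) : IsTightLink G K (fun v => v ∉ Ls.flatten) W := by
  obtain ⟨L₁, L₂, rfl⟩ := List.append_of_mem hW
  have hperm : ∀ N : List V, (L₁ ++ N :: L₂).flatten.Perm (N ++ (L₁ ++ L₂).flatten) := by
    intro N
    rw [List.perm_iff_count]
    intro v
    simp only [List.flatten_append, List.flatten_cons, List.count_append]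
    omega
  have hn := (hperm W).nodup_iff.mp h.nodup
  have hmem : ∀ v, v ∈ W ++ (L₁ ++ L₂).flatten ↔ v ∈ (L₁ ++ W :: L₂).flatten :=
    fun v => ((hperm W).mem_iff).symm
  refine ⟨h.link W hW, (List.nodup_append.mp hn).1,
    fun v hv => not_not.mpr ((hmem v).mp (List.mem_append_left _ hv)), fun N hN hnN hv => ?_⟩
  have := hmax (L₁ ++ N :: L₂) ⟨?_, ?_⟩
  · rw [(hperm N).outCount_eq, (hperm W).outCount_eq, outCount_append, outCount_append] at this
    omega
  · intro l hl
    rcases List.mem_append.mp hl with hl | hl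
    · exact h.link l (by simp [hl])
    · rcases List.mem_cons.mp hl with rfl | hl
      · exact hN
      · exact h.link l (by simp [hl])
  · rw [(hperm N).nodup_iff, List.nodup_append]
    refine ⟨hnN, (List.nodup_append.mp hn).2.1, ?_⟩
    rintro v hvN w hw rfl
    rcases hv v hvN with h' | h'
    · exact (List.nodup_append.mp hn).2.2 v h' v hw rfl
    · exact h' ((hmem v).mp (List.mem_append_right _ hw))

/-- A tight link cannot be enlarged by a list of free vertices outside `K`. -/
lemma IsTightLink.false_of_perm {Free : V → Prop} {W N P : List V}
    (h : IsTightLink G K Free W) (hP : ∀ v ∈ P, Free v ∧ v ∉ K) (hPn : P.Nodup) (hPne : P ≠ [])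
    (hx : x ∈ K) (hy : y ∈ K) (hN : IsSeg G x y N) (hp : N.Perm (P ++ W)) : False := by
  have h0 : inCount K P = 0 := inCount_eq_zero.mpr fun v hv => (hP v hv).2
  have hlen := List.length_pos_iff.mpr hPne
  have hout := outCount_eq_length fun v hv => (hP v hv).2
  have := h.le N ⟨⟨x, y, hx, hy, hN⟩, by rw [hp.inCount_eq, inCount_append, h0, h.count],
      by rw [hp.outCount_eq, outCount_append]; omega⟩ (by
    rw [hp.nodup_iff, List.nodup_append]
    refine ⟨hPn, h.nodup, ?_⟩
    rintro v hv w hw rfl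
    exact h.not_free v hw (hP v hv).1) fun v hv => by
      rcases List.mem_append.mp (hp.mem_iff.mp hv) with h' | h'
      · exact .inr (hP v h').1
      · exact .inl h'
  rw [hp.outCount_eq, outCount_append] at this
  omega

lemma IsTightLink.false_of_insert {Free : V → Prop} {A B P : List V} {p q d' : V}
    (h : IsTightLink G K Free (A ++ B)) (hP : ∀ v ∈ P, Free v ∧ v ∉ K) (hPn : P.Nodup)
    (hPs : IsSeg G d d' P) (hA : IsSeg G x p A) (hpq : G.Adj p q) (hB : IsSeg G q y B)
    (hpd : G.Adj p d) (hdq : G.Adj d' q) : False := by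
  obtain ⟨x', y', hx, hy, hs⟩ := h.ends
  obtain ⟨rfl, rfl⟩ := hs.ends_unique (hA.append hpq hB)
  refine h.false_of_perm hP hPn hPs.ne_nil hx hy ((hA.append hpd hPs).append hdq hB) ?_
  rw [List.perm_iff_count]
  intro v
  simp only [List.count_append]
  omega

/-- The two neighbours on a tight link of a vertex adjacent to a free vertex are adjacent. -/
lemma IsTightLink.adj_of_adj_free {Free : V → Prop} (hclaw : ClawFree G) {A B : List V}
    {p q w : V} (h : IsTightLink G K Free (A ++ ([w] ++ B))) (hA : IsSeg G x p A)
    (hpw : G.Adj p w) (hwq : G.Adj w q) (hB : IsSeg G q y B) (hd : Free d) (hdK : d ∉ K)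
    (hwd : G.Adj w d) : G.Adj p q := by
  have hP : ∀ v ∈ [d], Free v ∧ v ∉ K := by simpa using ⟨hd, hdK⟩
  have hpd : p ≠ d := by
    rintro rfl
    exact h.not_free p (by simp [hA.mem_right]) hd
  have hqd : q ≠ d := by
    rintro rfl
    exact h.not_free q (by simp [hB.mem_left]) hd
  have hpq : p ≠ q := by
    have := h.nodup
    rw [List.nodup_append] at this
    exact this.2.2 _ hA.mem_right _ (by simp [hB.mem_left])
  rcases hclaw.adj_or hpw.symm hwq hwd hpq hpd hqd with h' | h' | h'
  · exact h'
  · exact (h.false_of_insert hP (by simp) (.single d) hA hpw ((IsSeg.single w).append hwq hB) h'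
      hwd.symm).elim
  · rw [← List.append_assoc] at h
    exact (h.false_of_insert hP (by simp) (.single d) (hA.snoc hpw) hwq hB hwd h'.symm).elim

end

section

variable {V : Type*} [DecidableEq V] {G : SimpleGraph V} {K : Finset V} {a b c d d' x y : V}
  {l : List V}

lemma inCount_add_outCount : inCount K l + outCount K l = l.length := by
  induction l with
  | nil => rfl
  | cons a l ih =>
    simp only [inCount_cons, outCount_cons, List.length_cons]
    split_ifs <;> omega

lemma inCount_pos (ha : a ∈ l) (haK : a ∈ K) : 1 ≤ inCount K l := by
  rw [Nat.one_le_iff_ne_zero, Ne, inCount_eq_zero]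
  exact fun h => h a ha haK

lemma inCount_eq_one {a : V} (hl : l.Nodup) (ha : a ∈ l) (haK : a ∈ K) (h : inCount K l = 1)
    (hb : b ∈ l) (hbK : b ∈ K) : b = a := by
  obtain ⟨l₁, l₂, rfl⟩ := List.append_of_mem ha
  simp only [inCount_append, inCount_cons, haK, if_true] at h
  have h₁ : inCount K l₁ = 0 := by omega
  have h₂ : inCount K l₂ = 0 := by omega
  rw [inCount_eq_zero] at h₁ h₂
  rcases List.mem_append.mp hb with hb | hb
  · exact absurd hbK (h₁ b hb)
  · rcases List.mem_cons.mp hb with rfl | hb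
    · rfl
    · exact absurd hbK (h₂ b hb)

/-- The shape of a link. -/
lemma IsLink.exists_eq (h : IsLink G K l) (hn : l.Nodup) :
    ∃ x y p q M, x ∈ K ∧ y ∈ K ∧ x ≠ y ∧ l = [x] ++ (M ++ [y]) ∧ (∀ v ∈ M, v ∉ K) ∧
      G.Adj x p ∧ IsSeg G p q M ∧ G.Adj q y ∧ outCount K l = M.length := by
  obtain ⟨⟨x, y, hx, hy, hs⟩, hc, ho⟩ := h
  obtain ⟨t, ht⟩ := hs.exists_snoc
  have hxt : ∃ M, t = x :: M := by
    obtain ⟨s, hs'⟩ := hs.exists_cons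
    rw [ht] at hs'
    rcases t with _ | ⟨z, M⟩
    · rw [ht] at hc
      simp [hy] at hc
    · simp only [List.cons_append, List.cons.injEq] at hs'
      exact ⟨M, by rw [hs'.1]⟩
  obtain ⟨M, rfl⟩ := hxt
  have hl : l = [x] ++ (M ++ [y]) := by rw [ht]; rfl
  rw [hl] at hc ho hs hn
  simp only [List.cons_append, List.nil_append, inCount_cons, inCount_append, inCount_nil, hx, hy,
    if_true, outCount_cons, outCount_append, outCount_nil] at hc ho
  have hM : ∀ v ∈ M, v ∉ K := inCount_eq_zero.mp (by omega)
  have hMne : M ≠ [] := by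
    rintro rfl
    simp at ho
  obtain ⟨p', q, h₁, hq, h₂⟩ := hs.split_append (l₁ := [x] ++ M) (l₂ := [y]) (by simp) (by simp)
    (by simp)
  obtain ⟨x', p, h₃, hp, h₄⟩ := h₁.split_append (l₁ := [x]) (l₂ := M) rfl (by simp) hMne
  obtain ⟨-, rfl⟩ := h₃.of_singleton
  obtain ⟨rfl, -⟩ := h₂.of_singleton
  refine ⟨_, _, p, p', M, hx, hy, ?_, hl, hM, hp, h₄, hq, ?_⟩
  · rintro rfl
    simp at hn
  · rw [hl]
    simp [hx, hy, outCount_eq_length hM]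

/-- In a tight link, an end is not adjacent to a free vertex. -/
lemma IsTightLink.mem_of_adj_free {Free : V → Prop} (hclaw : ClawFree G) (hK : IsIsolatedClique G K)
    (h2 : 2 ≤ K.card) {W : List V} (h : IsTightLink G K Free W) (hd : Free d) (hdK : d ∉ K)
    (hcK : c ∈ K) (hdc : G.Adj d c) : c ∉ W := by
  have key : ∀ {W : List V}, IsTightLink G K Free W → ∀ t, W ≠ c :: t := by
    rintro W h t rfl
    obtain ⟨x, y, p, q, M, hx, hy, hxy, he, hM, hxp, hs, hqy, -⟩ := h.exists_eq h.nodup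
    rw [he] at h
    simp only [List.cons_append, List.nil_append, List.cons.injEq] at he
    obtain ⟨rfl, -⟩ := he
    have hpd : p ≠ d := by
      rintro rfl
      exact h.not_free p (by simp [hs.mem_left]) hd
    exact h.false_of_insert (P := [d]) (by simpa using ⟨hd, hdK⟩) (by simp) (.single d)
      (.single c) hxp (hs.snoc hqy) hdc.symm
      (hK.adj_of_common hclaw h2 hcK (hM p hs.mem_left) hdK hxp hdc.symm hpd).symm
  intro hcW
  obtain ⟨x, y, p, q, M, hx, hy, hxy, he, hM, -⟩ := h.exists_eq h.nodup
  rw [he] at hcW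
  simp only [List.cons_append, List.nil_append, List.mem_cons, List.mem_append, List.not_mem_nil,
    or_false] at hcW
  rcases hcW with rfl | hcM | rfl
  · exact key h _ he
  · exact hM c hcM hcK
  · refine key h.reverse (([x] ++ M).reverse) ?_
    rw [he]
    simp

/-- If a vertex of a tight link has a free path to a free vertex of the clique, then both sides of
it are long. -/
lemma IsTightLink.two_le_outCount {Free : V → Prop} {A B P : List V} {p q w : V}
    (h : IsTightLink G K Free (A ++ ([w] ++ B))) (hx : x ∈ K) (hy : y ∈ K) (hw : w ∉ K)
    (hA : IsSeg G x p A) (hpw : G.Adj p w) (hwq : G.Adj w q) (hB : IsSeg G q y B)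
    (hpq : G.Adj p q) (hP : ∀ v ∈ P, Free v ∧ v ∉ K) (hPn : P.Nodup) (hPs : IsSeg G d d' P)
    (hwd : G.Adj w d) (hdc : G.Adj d' c) (hcK : c ∈ K) (hc : Free c) :
    1 + P.length ≤ outCount K B := by
  have hP0 : inCount K P = 0 := inCount_eq_zero.mpr fun v hv => (hP v hv).2
  have hP1 := outCount_eq_length fun v hv => (hP v hv).2
  have hPlen := List.length_pos_iff.mpr hPs.ne_nil
  have hcnt := h.count
  simp only [inCount_append, inCount_cons, inCount_nil, hw, if_false] at hcnt
  have hA1 := inCount_pos hA.mem_left hx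
  have hB1 := inCount_pos hB.mem_right hy
  have hWn := h.nodup
  have hcP : c ∉ P := fun hcP => (hP c hcP).2 hcK
  have hdis : ∀ v ∈ A ++ ([w] ++ B), v ∉ P := fun v hv hvP => h.not_free v hv (hP v hvP).1
  have hdisc : ∀ v ∈ A ++ ([w] ++ B), v ≠ c := by
    rintro v hv rfl
    exact h.not_free v hv hc
  have hle : ∀ N, IsSeg G x c N → N.Nodup → (∀ v ∈ N, v ∈ A ++ ([w] ++ B) ∨ Free v) →
      inCount K N = 2 → 1 ≤ outCount K N → outCount K N ≤ outCount K A + 1 + outCount K B := by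
    intro N hN hNn hv h2 h1
    have := h.le N ⟨⟨x, c, hx, hcK, hN⟩, h2, h1⟩ hNn hv
    simp only [outCount_append, outCount_cons, outCount_nil, hw, if_false] at this
    omega
  by_cases hqK : q ∈ K
  · have hBout : outCount K B = 0 := by
      obtain ⟨B', rfl⟩ := hB.exists_cons
      have hBn : (q :: B').Nodup := (List.nodup_append.mp
        (List.nodup_append.mp hWn).2.1).2.1
      have : y = q := inCount_eq_one hBn hB.mem_left hqK (by omega) hB.mem_right hy
      subst this
      have := hB.length_eq_one_of_nodup hBn
      have h' := inCount_add_outCount (K := K) (l := y :: B')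
      omega
    have := hle _ ((hA.snoc hpw).append hwd (hPs.snoc hdc)) ?_ ?_ ?_ ?_
    · simp only [outCount_append, outCount_cons, outCount_nil, hw, if_false] at this
      omega
    · simp only [List.nodup_append, List.mem_append, List.mem_singleton, List.nodup_cons,
        List.not_mem_nil, not_false_eq_true, List.nodup_nil, and_true, true_and] at hWn ⊢
      grind
    · intro v
      simp only [List.mem_append, List.mem_singleton]
      grind
    · simp only [inCount_append, inCount_cons, inCount_nil, hw, hcK, if_false, if_true]
      omega
    · simp only [outCount_append, outCount_cons, outCount_nil, hw, if_false]
      omega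
  · have := hle _ ((hA.snoc hpq).append hwq.symm ((IsSeg.single w).append hwd (hPs.snoc hdc)))
      ?_ ?_ ?_ ?_
    · simp only [outCount_append, outCount_cons, outCount_nil, hw, hqK, if_false] at this
      omega
    · have := hB.mem_left
      have := hwq.ne
      simp only [List.nodup_append, List.mem_append, List.mem_singleton, List.nodup_cons,
        List.not_mem_nil, not_false_eq_true, List.nodup_nil, and_true, true_and] at hWn ⊢
      grind
    · intro v
      have := hB.mem_left
      simp only [List.mem_append, List.mem_singleton]
      grind
    · simp only [inCount_append, inCount_cons, inCount_nil, hw, hqK, hcK, if_false, if_true]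
      omega
    · simp only [outCount_append, outCount_cons, outCount_nil, hw, if_false]
      omega

end

section

lemma EPgraph_adj_of_lt {n m : ℕ} (hnm : n = m + 6) {i j : Fin n} (hi : i.val < m)
    (hj : j.val < m) : (EPgraph n).Adj i j ↔ i.val ≠ j.val := by
  rw [EPgraph_adj, Ne, Fin.ext_iff]
  exact ⟨fun h => h.1, fun h => ⟨h, .inl (.inl (by omega))⟩⟩

lemma EPgraph_adj_of_eq_of_lt {n m k : ℕ} (hnm : n = m + 6) (hm : 3 ≤ m) {i j : Fin n}
    (hi : i.val = m + k) (hj : j.val < m) :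
    (EPgraph n).Adj i j ↔ j.val = k % 3 := by
  rw [EPgraph_adj, Ne, Fin.ext_iff]
  constructor
  · omega
  · intro h
    exact ⟨by omega, .inr (.inr (.inr (.inl (by omega))))⟩

lemma EPgraph_adj_of_eq_of_eq {n m k l : ℕ} (hnm : n = m + 6) (hm : 3 ≤ m) {i j : Fin n}
    (hi : i.val = m + k) (hj : j.val = m + l) :
    (EPgraph n).Adj i j ↔ k ≠ l ∧ (k < 3 ∧ l < 3 ∨ l = k + 3 ∨ k = l + 3) := by
  rw [EPgraph_adj, Ne, Fin.ext_iff]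
  constructor
  · omega
  · rintro ⟨h₁, h₂ | h₂ | h₂⟩
    · exact ⟨by omega, .inl (.inr (.inl (by omega)))⟩
    · exact ⟨by omega, .inl (.inr (.inr (.inr (by omega))))⟩
    · exact ⟨by omega, .inr (.inr (.inr (.inr (by omega))))⟩

variable {V : Type*} {G : SimpleGraph V} {K : Finset V}

/-- The configuration around an isolated clique `K` in which a link `x, w₁, …, w₅, y` and a
vertex `d` adjacent to `w₃` and to `c ∈ K` make up everything outside `K`, and no spanning cycle
exists. -/
structure IsExtremalConfig (G : SimpleGraph V) (K : Finset V) (x y c w₁ w₂ w₃ w₄ w₅ d : V) :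
    Prop where
  clawFree : ClawFree G
  isolated : IsIsolatedClique G K
  two_le : 2 ≤ K.card
  attached : ∀ s ∉ K, ∃ a ∈ K, G.Adj s a
  no_cycle : ¬ HasHamList G
  x_mem : x ∈ K
  y_mem : y ∈ K
  c_mem : c ∈ K
  nodup : [x, y, c, w₁, w₂, w₃, w₄, w₅, d].Nodup
  not_mem_iff : ∀ v, v ∉ K ↔ v ∈ [w₁, w₂, w₃, w₄, w₅, d]
  x_w₁ : G.Adj x w₁
  w₁_w₂ : G.Adj w₁ w₂
  w₂_w₃ : G.Adj w₂ w₃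
  w₃_w₄ : G.Adj w₃ w₄
  w₄_w₅ : G.Adj w₄ w₅
  w₅_y : G.Adj w₅ y
  w₂_w₄ : G.Adj w₂ w₄
  w₃_d : G.Adj w₃ d
  d_c : G.Adj d c

namespace IsExtremalConfig

variable {x y c w₁ w₂ w₃ w₄ w₅ d : V}

lemma symm (h : IsExtremalConfig G K x y c w₁ w₂ w₃ w₄ w₅ d) :
    IsExtremalConfig G K y x c w₅ w₄ w₃ w₂ w₁ d where
  clawFree := h.clawFree
  isolated := h.isolated
  two_le := h.two_le
  attached := h.attached
  no_cycle := h.no_cycle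
  x_mem := h.y_mem
  y_mem := h.x_mem
  c_mem := h.c_mem
  nodup := by
    have := h.nodup
    grind
  not_mem_iff v := by
    rw [h.not_mem_iff]
    grind
  x_w₁ := h.w₅_y.symm
  w₁_w₂ := h.w₄_w₅.symm
  w₂_w₃ := h.w₃_w₄.symm
  w₃_w₄ := h.w₂_w₃.symm
  w₄_w₅ := h.w₁_w₂.symm
  w₅_y := h.x_w₁.symm
  w₂_w₄ := h.w₂_w₄.symm
  w₃_d := h.w₃_d
  d_c := h.d_c

lemma ne (h : IsExtremalConfig G K x y c w₁ w₂ w₃ w₄ w₅ d) :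
    (x ≠ y ∧ x ≠ c ∧ x ≠ w₁ ∧ x ≠ w₂ ∧ x ≠ w₃ ∧ x ≠ w₄ ∧ x ≠ w₅ ∧ x ≠ d) ∧
      (y ≠ c ∧ y ≠ w₁ ∧ y ≠ w₂ ∧ y ≠ w₃ ∧ y ≠ w₄ ∧ y ≠ w₅ ∧ y ≠ d) ∧
      (c ≠ w₁ ∧ c ≠ w₂ ∧ c ≠ w₃ ∧ c ≠ w₄ ∧ c ≠ w₅ ∧ c ≠ d) ∧
      (w₁ ≠ w₂ ∧ w₁ ≠ w₃ ∧ w₁ ≠ w₄ ∧ w₁ ≠ w₅ ∧ w₁ ≠ d) ∧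
      (w₂ ≠ w₃ ∧ w₂ ≠ w₄ ∧ w₂ ≠ w₅ ∧ w₂ ≠ d) ∧
      (w₃ ≠ w₄ ∧ w₃ ≠ w₅ ∧ w₃ ≠ d) ∧
      (w₄ ≠ w₅ ∧ w₄ ≠ d) ∧
      (w₅ ≠ d) := by
  have hn := h.nodup
  simp only [List.nodup_cons, List.mem_cons, List.not_mem_nil, not_or, or_false, not_false_eq_true,
    List.nodup_nil, and_true] at hn
  exact hn

lemma x_ne_y (h : IsExtremalConfig G K x y c w₁ w₂ w₃ w₄ w₅ d) : x ≠ y := h.ne.1.1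

lemma x_ne_c (h : IsExtremalConfig G K x y c w₁ w₂ w₃ w₄ w₅ d) : x ≠ c := h.ne.1.2.1

lemma not_mem (h : IsExtremalConfig G K x y c w₁ w₂ w₃ w₄ w₅ d) :
    w₁ ∉ K ∧ w₂ ∉ K ∧ w₃ ∉ K ∧ w₄ ∉ K ∧ w₅ ∉ K ∧ d ∉ K := by
  simp [h.not_mem_iff]

lemma eq_of_adj (h : IsExtremalConfig G K x y c w₁ w₂ w₃ w₄ w₅ d) {s a b : V} (hs : s ∉ K)
    (ha : a ∈ K) (hb : b ∈ K) (hsa : G.Adj s a) (hsb : G.Adj s b) : a = b :=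
  h.isolated.unique s hs a ha b hb hsa hsb

lemma adj_iff_eq (h : IsExtremalConfig G K x y c w₁ w₂ w₃ w₄ w₅ d) {s a b : V} (hs : s ∉ K)
    (ha : a ∈ K) (hsa : G.Adj s a) (hb : b ∈ K) : G.Adj s b ↔ b = a :=
  ⟨fun h' => h.eq_of_adj hs hb ha h' hsa, fun e => e ▸ hsa⟩

lemma card_le [Fintype V] (h : IsExtremalConfig G K x y c w₁ w₂ w₃ w₄ w₅ d) :
    3 ≤ Fintype.card V := by
  classical
  calc 3 ≤ [x, y, c, w₁, w₂, w₃, w₄, w₅, d].toFinset.card := by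
        rw [List.toFinset_card_of_nodup h.nodup]
        simp
    _ ≤ _ := Finset.card_le_univ _

lemma false_of_path [Fintype V] [DecidableEq V]
    (h : IsExtremalConfig G K x y c w₁ w₂ w₃ w₄ w₅ d) {a b s₁ s₂ s₃ s₄ s₅ s₆ : V}
    (ha : a ∈ K) (hb : b ∈ K) (hab : a ≠ b)
    (h₀ : G.Adj a s₁)
    (h₁ : G.Adj s₁ s₂) (h₂ : G.Adj s₂ s₃) (h₃ : G.Adj s₃ s₄) (h₄ : G.Adj s₄ s₅)
    (h₅ : G.Adj s₅ s₆) (h₆ : G.Adj s₆ b)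
    (hp : [s₁, s₂, s₃, s₄, s₅, s₆].Perm [w₁, w₂, w₃, w₄, w₅, d] := by
      rw [List.perm_iff_count]
      intro v
      simp only [List.count_cons, List.count_nil]
      ring) : False := by
  have hS : ∀ v, v ∉ K ↔ v ∈ [s₁, s₂, s₃, s₄, s₅, s₆] := fun v =>
    (h.not_mem_iff v).trans hp.mem_iff.symm
  have hn : [s₁, s₂, s₃, s₄, s₅, s₆].Nodup := by
    rw [hp.nodup_iff]
    have := h.nodup
    grind
  refine h.no_cycle (IsLinkSystem.hasHamList (K := K) (Ls := [[a, s₁, s₂, s₃, s₄, s₅, s₆, b]])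
    h.card_le h.isolated.adj ⟨?_, ?_⟩ ?_)
  · intro l hl
    rw [List.mem_singleton] at hl
    subst hl
    have hs : ∀ v ∈ [s₁, s₂, s₃, s₄, s₅, s₆], v ∉ K := fun v hv => (hS v).mpr hv
    simp only [List.mem_cons, List.not_mem_nil, or_false, forall_eq_or_imp, forall_eq] at hs
    obtain ⟨k₁, k₂, k₃, k₄, k₅, k₆⟩ := hs
    exact ⟨⟨a, b, ha, hb, .cons h₀ (.cons h₁ (.cons h₂ (.cons h₃ (.cons h₄ (.cons h₅
      (.cons h₆ (.single b)))))))⟩, by simp [*], by simp [*]⟩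
  · have hs := hS a
    have hs' := hS b
    rw [List.flatten_singleton, List.nodup_cons]
    refine ⟨?_, ?_⟩
    · change a ∉ [s₁, s₂, s₃, s₄, s₅, s₆] ++ [b]
      rw [List.mem_append, List.mem_singleton]
      rintro (h' | h')
      · exact hs.mpr h' ha
      · exact hab h'
    · change ([s₁, s₂, s₃, s₄, s₅, s₆] ++ [b]).Nodup
      rw [List.nodup_append]
      refine ⟨hn, List.nodup_singleton b, ?_⟩
      rintro v hv w hw rfl
      rw [List.mem_singleton] at hw
      subst hw
      exact hs'.mpr hv hb
  · intro v hv
    have := (hS v).mp hv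
    simp only [List.flatten_cons, List.flatten_nil, List.append_nil]
    grind

variable [Fintype V] [DecidableEq V]

lemma not_w₂_d (h : IsExtremalConfig G K x y c w₁ w₂ w₃ w₄ w₅ d) : ¬ G.Adj w₂ d := fun h' =>
  h.false_of_path h.x_mem h.y_mem h.x_ne_y h.x_w₁ h.w₁_w₂ h' h.w₃_d.symm h.w₃_w₄ h.w₄_w₅ h.w₅_y

lemma not_w₁_w₄ (h : IsExtremalConfig G K x y c w₁ w₂ w₃ w₄ w₅ d) : ¬ G.Adj w₁ w₄ := fun h' =>
  h.false_of_path h.y_mem h.c_mem h.symm.x_ne_c h.w₅_y.symm h.w₄_w₅.symm h'.symm h.w₁_w₂ h.w₂_w₃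
    h.w₃_d h.d_c

lemma not_w₁_w₃ (h : IsExtremalConfig G K x y c w₁ w₂ w₃ w₄ w₅ d) : ¬ G.Adj w₁ w₃ := fun h' =>
  h.false_of_path h.y_mem h.c_mem h.symm.x_ne_c h.w₅_y.symm h.w₄_w₅.symm h.w₂_w₄.symm h.w₁_w₂.symm
    h' h.w₃_d h.d_c

lemma not_w₄_x (h : IsExtremalConfig G K x y c w₁ w₂ w₃ w₄ w₅ d) : ¬ G.Adj w₄ x := fun h₄ => by
  have := h.not_mem
  have hn := h.ne
  exact h.not_w₁_w₄ (h.isolated.adj_of_common h.clawFree h.two_le h.x_mem this.1 this.2.2.2.1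
    h.x_w₁ h₄.symm (by grind))

lemma w₃_c (h : IsExtremalConfig G K x y c w₁ w₂ w₃ w₄ w₅ d) : G.Adj w₃ c := by
  obtain ⟨k₁, k₂, k₃, k₄, k₅, k₆⟩ := h.not_mem
  have hn := h.ne
  have hS := h.not_mem_iff
  obtain ⟨v, hv, h₃⟩ := h.attached w₃ k₃
  by_cases hvc : v = c
  · rwa [← hvc]
  have hvd : ¬ G.Adj d v := fun h' => hvc (h.eq_of_adj k₆ hv h.c_mem h' h.d_c)
  have hvS := mt (hS v).mpr (not_not.mpr hv)
  simp only [List.mem_cons, List.not_mem_nil, not_or, or_false] at hvS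
  have h₂ : G.Adj w₂ v := by
    rcases h.clawFree.adj_or h.w₂_w₃.symm h.w₃_d h₃ (by grind) (by grind) (by grind)
      with h' | h' | h'
    · exact (h.not_w₂_d h').elim
    · exact h'
    · exact (hvd h').elim
  have h₄ : G.Adj w₄ v := by
    rcases h.clawFree.adj_or h.w₃_w₄ h.w₃_d h₃ (by grind) (by grind) (by grind)
      with h' | h' | h'
    · exact (h.symm.not_w₂_d h').elim
    · exact h'
    · exact (hvd h').elim
  by_cases hvx : v = x
  · subst hvx
    exact (h.not_w₄_x h₄).elim
  by_cases hvy : v = y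
  · subst hvy
    exact (h.symm.not_w₄_x h₂).elim
  have hxK := h.x_mem
  have hyK := h.y_mem
  have hcK := h.c_mem
  refine (h.no_cycle (IsLinkSystem.hasHamList (K := K)
    (Ls := [[x, w₁, w₂, v], [y, w₅, w₄, w₃, d, c]]) h.card_le h.isolated.adj ⟨?_, ?_⟩ ?_)).elim
  · intro l hl
    simp only [List.mem_cons, List.not_mem_nil, or_false] at hl
    rcases hl with rfl | rfl
    · exact ⟨⟨x, v, hxK, hv, .cons h.x_w₁ (.cons h.w₁_w₂ (.cons h₂ (.single v)))⟩, by simp [*],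
        by simp [*]⟩
    · exact ⟨⟨y, c, hyK, hcK, .cons h.w₅_y.symm (.cons h.w₄_w₅.symm (.cons h.w₃_w₄.symm
        (.cons h.w₃_d (.cons h.d_c (.single c)))))⟩, by simp [*], by simp [*]⟩
  · have hp : [[x, w₁, w₂, v], [y, w₅, w₄, w₃, d, c]].flatten.Perm
        (v :: [x, y, c, w₁, w₂, w₃, w₄, w₅, d]) := by
      rw [List.perm_iff_count]
      intro u
      simp only [List.flatten_cons, List.flatten_nil, List.count_append, List.count_cons,
        List.count_nil]
      ring
    rw [hp.nodup_iff, List.nodup_cons]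
    refine ⟨?_, h.nodup⟩
    grind
  · intro u hu
    have := (hS u).mp hu
    simp only [List.flatten_cons, List.flatten_nil]
    grind

lemma w₂_x (h : IsExtremalConfig G K x y c w₁ w₂ w₃ w₄ w₅ d) : G.Adj w₂ x := by
  obtain ⟨k₁, k₂, k₃, k₄, k₅, k₆⟩ := h.not_mem
  have hn := h.ne
  obtain ⟨v, hv, h₂⟩ := h.attached w₂ k₂
  have hvS := mt (h.not_mem_iff v).mpr (not_not.mpr hv)
  simp only [List.mem_cons, List.not_mem_nil, not_or, or_false] at hvS
  rcases h.clawFree.adj_or h.w₁_w₂.symm h.w₂_w₃ h₂ (by grind) (by grind) (by grind)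
    with h' | h' | h'
  · exact (h.not_w₁_w₃ h').elim
  · rwa [← h.eq_of_adj k₁ hv h.x_mem h' h.x_w₁.symm]
  · obtain rfl := h.eq_of_adj k₃ hv h.c_mem h' h.w₃_c
    exact (h.not_w₂_d (h.isolated.adj_of_common h.clawFree h.two_le hv k₂ k₆ h₂.symm h.d_c.symm
      (by grind))).elim

lemma not_w₁_w₅ (h : IsExtremalConfig G K x y c w₁ w₂ w₃ w₄ w₅ d) : ¬ G.Adj w₁ w₅ := fun h' =>
  h.false_of_path h.x_mem h.c_mem h.x_ne_c h.w₂_x.symm h.w₁_w₂.symm h' h.w₄_w₅.symm h.w₃_w₄.symm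
    h.w₃_d h.d_c

lemma not_w₁_d (h : IsExtremalConfig G K x y c w₁ w₂ w₃ w₄ w₅ d) : ¬ G.Adj w₁ d := fun h' =>
  h.false_of_path h.x_mem h.y_mem h.x_ne_y h.w₂_x.symm h.w₁_w₂.symm h' h.w₃_d.symm h.w₃_w₄
    h.w₄_w₅ h.w₅_y

/-- The extremal configuration is the graph `EP`. -/
lemma nonempty_iso_of_index (h : IsExtremalConfig G K x y c w₁ w₂ w₃ w₄ w₅ d)
    {n m : ℕ} (hnm : n = m + 6) (hm : 3 ≤ m) (hcard : Fintype.card V = n)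
    (f : V → ℕ) (hf : f.Injective) (hfn : ∀ v, f v < n) (hfK : ∀ v ∈ K, f v < m)
    (fx : f x = 0) (fc : f c = 1) (fy : f y = 2) (f₂ : f w₂ = m + 0) (f₃ : f w₃ = m + 1)
    (f₄ : f w₄ = m + 2) (f₁ : f w₁ = m + 3) (fd : f d = m + 4) (f₅ : f w₅ = m + 5) :
    Nonempty (G ≃g EPgraph n) := by
  obtain ⟨k₁, k₂, k₃, k₄, k₅, k₆⟩ := h.not_mem
  have hbij : (fun v => (⟨f v, hfn v⟩ : Fin n)).Bijective := by
    rw [Fintype.bijective_iff_injective_and_card]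
    refine ⟨fun u v huv => hf (by simpa using huv), by simp [hcard]⟩
  have hfne : ∀ u v, u = v ↔ f u = f v := fun u v => hf.eq_iff.symm
  have hKS : ∀ u ∈ K, ∀ v ∉ K, (EPgraph n).Adj ⟨f v, hfn v⟩ ⟨f u, hfn u⟩ ↔ G.Adj v u := by
    intro u hu v hv
    have hu' := hfK u hu
    have hv' := (h.not_mem_iff v).mp hv
    simp only [List.mem_cons, List.not_mem_nil, or_false] at hv'
    rcases hv' with rfl | rfl | rfl | rfl | rfl | rfl
    · rw [h.adj_iff_eq k₁ h.x_mem h.x_w₁.symm hu, hfne, fx,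
        EPgraph_adj_of_eq_of_lt hnm hm f₁ hu']
    · rw [h.adj_iff_eq k₂ h.x_mem h.w₂_x hu, hfne, fx,
        EPgraph_adj_of_eq_of_lt hnm hm f₂ hu']
    · rw [h.adj_iff_eq k₃ h.c_mem h.w₃_c hu, hfne, fc,
        EPgraph_adj_of_eq_of_lt hnm hm f₃ hu']
    · rw [h.adj_iff_eq k₄ h.y_mem h.symm.w₂_x hu, hfne, fy,
        EPgraph_adj_of_eq_of_lt hnm hm f₄ hu']
    · rw [h.adj_iff_eq k₅ h.y_mem h.w₅_y hu, hfne, fy,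
        EPgraph_adj_of_eq_of_lt hnm hm f₅ hu']
    · rw [h.adj_iff_eq k₆ h.c_mem h.d_c hu, hfne, fc,
        EPgraph_adj_of_eq_of_lt hnm hm fd hu']
  refine ⟨⟨Equiv.ofBijective _ hbij, ?_⟩⟩
  intro u v
  rw [Equiv.ofBijective_apply, Equiv.ofBijective_apply]
  by_cases hu : u ∈ K <;> by_cases hv : v ∈ K
  · have h' : G.Adj u v ↔ u ≠ v := ⟨fun h' => h'.ne, h.isolated.adj u hu v hv⟩
    have hu' := hfK u hu
    have hv' := hfK v hv
    rw [h', EPgraph_adj_of_lt hnm hu' hv', Ne, Ne, hfne]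
  · rw [G.adj_comm, (EPgraph n).adj_comm]
    exact hKS u hu v hv
  · exact hKS v hv u hu
  · have hu' := (h.not_mem_iff u).mp hu
    have hv' := (h.not_mem_iff v).mp hv
    have e₁ := h.not_w₁_w₃
    have e₂ := h.not_w₁_w₄
    have e₃ := h.not_w₁_w₅
    have e₄ := h.not_w₁_d
    have e₅ := h.not_w₂_d
    have e₆ := h.symm.not_w₁_w₃
    have e₇ := h.symm.not_w₁_w₄
    have e₈ := h.symm.not_w₁_d
    have e₉ := h.symm.not_w₂_d
    have t₁ := h.w₁_w₂
    have t₂ := h.w₂_w₃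
    have t₃ := h.w₃_w₄
    have t₄ := h.w₄_w₅
    have t₅ := h.w₂_w₄
    have t₆ := h.w₃_d
    simp only [List.mem_cons, List.not_mem_nil, or_false] at hu' hv'
    have hsymm : ∀ {u v : V}, ¬ G.Adj u v → ¬ G.Adj v u := fun hn h' => hn h'.symm
    have key : ∀ {k l : ℕ} {u v : V}, f u = m + k → f v = m + l →
        (G.Adj u v ↔ k ≠ l ∧ (k < 3 ∧ l < 3 ∨ l = k + 3 ∨ k = l + 3)) →
        ((EPgraph n).Adj ⟨f u, hfn u⟩ ⟨f v, hfn v⟩ ↔ G.Adj u v) :=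
      fun hk hl h' => (EPgraph_adj_of_eq_of_eq hnm hm hk hl).trans h'.symm
    rcases hu' with rfl | rfl | rfl | rfl | rfl | rfl <;>
      rcases hv' with rfl | rfl | rfl | rfl | rfl | rfl <;>
      refine key (by assumption) (by assumption) ?_ <;>
      simp [e₁, e₂, e₃, e₄, e₅, e₆, e₇, e₈, e₉, hsymm e₁, hsymm e₂, hsymm e₃, hsymm e₄, hsymm e₅,
        hsymm e₆, hsymm e₇, hsymm e₈, hsymm e₉, t₁, t₂, t₃, t₄, t₅, t₆, t₁.symm, t₂.symm, t₃.symm,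
        t₄.symm, t₅.symm, t₆.symm]

lemma nonempty_iso (h : IsExtremalConfig G K x y c w₁ w₂ w₃ w₄ w₅ d)
    {n : ℕ} (hcard : Fintype.card V = n) : Nonempty (G ≃g EPgraph n) := by
  obtain ⟨k₁, k₂, k₃, k₄, k₅, k₆⟩ := h.not_mem
  have hn := h.ne
  have hxK := h.x_mem
  have hyK := h.y_mem
  have hcK := h.c_mem
  set T : List V := [x, c, y] ++ (K \ {x, c, y}).toList with hT
  set L : List V := [w₂, w₃, w₄, w₁, d, w₅] with hL
  have hTmem : ∀ v, v ∈ T ↔ v ∈ K := by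
    intro v
    simp only [hT, List.mem_append, List.mem_cons, List.not_mem_nil, or_false,
      Finset.mem_toList, Finset.mem_sdiff, Finset.mem_insert, Finset.mem_singleton]
    grind
  have hTn : T.Nodup := by
    rw [hT, List.nodup_append]
    refine ⟨by grind, Finset.nodup_toList _, ?_⟩
    simp only [List.mem_cons, List.not_mem_nil, or_false,
      Finset.mem_toList, Finset.mem_sdiff, Finset.mem_insert, Finset.mem_singleton]
    grind
  have hLmem : ∀ v, v ∈ L ↔ v ∉ K := by
    intro v
    rw [h.not_mem_iff]
    grind
  have hall : ∀ v, v ∈ T ++ L := by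
    intro v
    rw [List.mem_append, hTmem, hLmem]
    exact em _
  have hTL : (T ++ L).Nodup := by
    rw [List.nodup_append]
    refine ⟨hTn, ?_, ?_⟩
    · simp only [hL, List.nodup_cons, List.mem_cons, List.not_mem_nil, not_or, or_false,
        not_false_eq_true, List.nodup_nil, and_true]
      grind
    rintro v hv w hw rfl
    exact (hLmem v).mp hw ((hTmem v).mp hv)
  have hlen : n = T.length + 6 := by
    rw [← hcard, ← Finset.card_univ, show (Finset.univ : Finset V) = (T ++ L).toFinset from
      (Finset.eq_univ_iff_forall.mpr fun v => List.mem_toFinset.mpr (hall v)).symm,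
      List.toFinset_card_of_nodup hTL]
    simp [hL]
  have hidx : ∀ v ∉ K, (T ++ L).idxOf v = T.length + L.idxOf v := by
    intro v hv
    rw [List.idxOf_append_of_notMem (by rwa [hTmem])]
  refine h.nonempty_iso_of_index hlen (by simp [hT]) hcard (fun v => (T ++ L).idxOf v)
    (fun u v huv => (List.idxOf_inj (hall u)).mp huv) (fun v => ?_) (fun v hv => ?_)
    ?_ ?_ ?_ ?_ ?_ ?_ ?_ ?_ ?_
  · have := List.idxOf_lt_length_iff.mpr (hall v)
    rw [List.length_append] at this
    simpa [hlen, hL] using this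
  · rw [List.idxOf_append_of_mem ((hTmem v).mpr hv)]
    exact List.idxOf_lt_length_iff.mpr ((hTmem v).mpr hv)
  · simp [hT]
  · simp only [hT, List.cons_append, List.idxOf_cons]
    grind
  · simp only [hT, List.cons_append, List.idxOf_cons]
    grind
  all_goals
    rw [hidx _ (by assumption), hL]
    simp only [List.idxOf_cons]
    grind

end IsExtremalConfig

end

section

variable {V : Type*} {G : SimpleGraph V} {K : Finset V} {c d d' x y : V}

/-- The vertices reachable from `d₀` inside the set `U`. -/
def ReachIn (G : SimpleGraph V) (U : V → Prop) (d₀ v : V) : Prop :=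
  ∃ l, IsSeg G d₀ v l ∧ ∀ u ∈ l, U u

namespace ReachIn

variable {U : V → Prop} {d₀ u v : V}

lemma refl (h : U d₀) : ReachIn G U d₀ d₀ := ⟨[d₀], .single d₀, by simpa using h⟩

lemma prop (h : ReachIn G U d₀ v) : U v := by
  obtain ⟨l, hl, h⟩ := h
  exact h v hl.mem_right

lemma step (h : ReachIn G U d₀ u) (huv : G.Adj u v) (hv : U v) : ReachIn G U d₀ v := by
  obtain ⟨l, hl, h⟩ := h
  refine ⟨_, hl.snoc huv, fun w hw => ?_⟩
  rcases List.mem_append.mp hw with hw | hw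
  · exact h w hw
  · rwa [List.mem_singleton.mp hw]

lemma exists_path [DecidableEq V] (h : ReachIn G U d₀ u) (h' : ReachIn G U d₀ v) :
    ∃ P, IsSeg G u v P ∧ P.Nodup ∧ ∀ w ∈ P, U w := by
  obtain ⟨l, hl, h⟩ := h
  obtain ⟨l', hl', h'⟩ := h'
  obtain ⟨l'', hs, hm⟩ := hl.reverse.trans hl'
  obtain ⟨P, hP, hn, hPm⟩ := hs.exists_nodup
  refine ⟨P, hP, hn, fun w hw => ?_⟩
  rcases hm w (hPm w hw) with hw | hw
  · exact h w (List.mem_reverse.mp hw)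
  · exact h' w hw

end ReachIn

variable [DecidableEq V]

/-- A tight link with a vertex adjacent to a free vertex has at least three vertices outside the
clique. -/
lemma IsTightLink.three_le_outCount {Free : V → Prop} {W : List V} {z : V} (hclaw : ClawFree G)
    (hK : IsIsolatedClique G K) (h : IsTightLink G K Free W) (hz : z ∈ W) (hzK : z ∉ K)
    (hd : Free d) (hdK : d ∉ K) (hzd : G.Adj z d) : 3 ≤ outCount K W := by
  obtain ⟨x, y, p, q, M, hx, hy, hxy, rfl, hM, hxp, hs, hqy, hlen⟩ := h.exists_eq h.nodup
  rw [hlen]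
  by_contra hlt
  have hz' : z ∈ M := by
    simp only [List.mem_append, List.mem_singleton] at hz
    rcases hz with rfl | hz | rfl
    · exact absurd hx hzK
    · exact hz
    · exact absurd hy hzK
  have huniq : ∀ s ∈ M, G.Adj s x → G.Adj s y → False := fun s hs h₁ h₂ =>
    hxy (hK.unique s (hM s hs) x hx y hy h₁ h₂)
  rcases M with _ | ⟨w₁, _ | ⟨w₂, _ | ⟨w₃, M⟩⟩⟩
  · simp at hz'
  · obtain ⟨rfl, rfl⟩ := hs.of_singleton
    exact huniq _ (by simp) hxp.symm hqy
  · obtain ⟨rfl, h₁₂, hs⟩ := hs.of_cons_cons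
    obtain ⟨-, rfl⟩ := hs.of_singleton
    simp only [List.mem_cons, List.not_mem_nil, or_false] at hz'
    rcases hz' with rfl | rfl
    · have := h.adj_of_adj_free (A := [x]) (B := [q, y]) hclaw (.single x) hxp h₁₂
        (.cons hqy (.single y)) hd hdK hzd
      exact huniq q (by simp) this.symm hqy
    · have := h.adj_of_adj_free (A := [x, p]) (B := [y]) hclaw (.cons hxp (.single p)) h₁₂ hqy
        (.single y) hd hdK hzd
      exact huniq p (by simp) hxp.symm this
  · simp at hlt

lemma IsTightLink.false_of_gap {Free : V → Prop} {A B P : List V} {p q v w : V}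
    (hclaw : ClawFree G) (h : IsTightLink G K Free (A ++ ([w] ++ ([v] ++ B))))
    (hP : ∀ u ∈ P, Free u ∧ u ∉ K) (hPn : P.Nodup) (hPs : IsSeg G d d' P) (hwd : G.Adj w d)
    (hdq : G.Adj d' q) (hA : IsSeg G x p A) (hpw : G.Adj p w) (hwv : G.Adj w v) (hvq : G.Adj v q)
    (hB : IsSeg G q y B) : False := by
  have hd := hP d hPs.mem_left
  have hpv := h.adj_of_adj_free hclaw hA hpw hwv ((IsSeg.single v).append hvq hB) hd.1 hd.2 hwd
  obtain ⟨x', y', hx, hy, hs⟩ := h.ends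
  obtain ⟨rfl, rfl⟩ := hs.ends_unique (hA.append hpw ((IsSeg.single w).append hwv
    ((IsSeg.single v).append hvq hB)))
  refine h.false_of_perm hP hPn hPs.ne_nil hx hy (hA.append hpv ((IsSeg.single v).append hwv.symm
    ((IsSeg.single w).append hwd (hPs.append hdq hB)))) ?_
  rw [List.perm_iff_count]
  intro u
  simp only [List.count_append]
  ring

variable [Fintype V]

lemma TwoConnected.exists_boundary (h : TwoConnected G) {D : V → Prop} {k : V} (hd : D d)
    (hk : ¬ D k) (hc : ¬ D c) (hkc : k ≠ c) : ∃ u z, D u ∧ ¬ D z ∧ z ≠ c ∧ G.Adj u z := by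
  have hdc : d ≠ c := by
    rintro rfl
    exact hc hd
  obtain ⟨p⟩ := (h.2 c).preconnected ⟨d, hdc⟩ ⟨k, hkc⟩
  obtain ⟨e, -, h₁, h₂⟩ := p.exists_boundary_dart {v | D v.1} hd hk
  exact ⟨e.fst.1, e.snd.1, h₁, h₂, e.snd.2, e.adj⟩

lemma TwoConnected.exists_two_boundary (h : TwoConnected G) {D : V → Prop} {k₁ k₂ : V} (hd : D d)
    (h₁ : ¬ D k₁) (h₂ : ¬ D k₂) (hk : k₁ ≠ k₂) : ∃ u z u' z', D u ∧ ¬ D z ∧ G.Adj u z ∧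
      D u' ∧ ¬ D z' ∧ G.Adj u' z' ∧ z ≠ z' := by
  obtain ⟨u, z, hu, hz, -, huz⟩ := h.exists_boundary hd h₂ h₁ hk.symm
  obtain ⟨k, hkD, hkz⟩ : ∃ k, ¬ D k ∧ k ≠ z := by
    by_cases e : k₁ = z
    · exact ⟨k₂, h₂, fun e' => hk (e.trans e'.symm)⟩
    · exact ⟨k₁, h₁, e⟩
  obtain ⟨u', z', hu', hz', hne, huz'⟩ := h.exists_boundary hd hkD hz hkz
  exact ⟨u, z, u', z', hu, hz, huz, hu', hz', huz', hne.symm⟩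

/-- A tight link together with a path of free vertices from it to the clique is an extremal
configuration. -/
lemma IsTightLink.nonempty_iso {Free : V → Prop} {W P : List V} {z : V} (hclaw : ClawFree G)
    (hK : IsIsolatedClique G K) (h2 : 2 ≤ K.card) (hS : Kᶜ.card ≤ 6)
    (hatt : Kᶜ.card = 6 → ∀ s ∉ K, ∃ a ∈ K, G.Adj s a) (hno : ¬ HasHamList G)
    (h : IsTightLink G K Free W) (hz : z ∈ W) (hzK : z ∉ K)
    (hP : ∀ v ∈ P, Free v ∧ v ∉ K) (hPn : P.Nodup) (hPs : IsSeg G d d' P) (hzd : G.Adj z d)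
    (hdc : G.Adj d' c) (hcK : c ∈ K) (hc : Free c) {n : ℕ} (hn : Fintype.card V = n) :
    Nonempty (G ≃g EPgraph n) := by
  obtain ⟨x, y, hx, hy, hs⟩ := h.ends
  obtain ⟨p, q, A, B, rfl, hA, hpz, hzq, hB⟩ := hs.split_mem hz (by
    rintro rfl
    exact hzK hx) (by
    rintro rfl
    exact hzK hy)
  have hpq := h.adj_of_adj_free hclaw hA hpz hzq hB (hP d hPs.mem_left).1 (hP d hPs.mem_left).2 hzd
  have hBc := h.two_le_outCount hx hy hzK hA hpz hzq hB hpq hP hPn hPs hzd hdc hcK hc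
  have hAc : 1 + P.length ≤ outCount K A := by
    have h' := h.reverse
    rw [show (A ++ ([z] ++ B)).reverse = B.reverse ++ ([z] ++ A.reverse) by simp] at h'
    have := h'.two_le_outCount hy hx hzK hB.reverse hzq.symm hpz.symm hA.reverse hpq.symm hP hPn
      hPs hzd hdc hcK hc
    rwa [(List.reverse_perm A).outCount_eq] at this
  have hPlen := List.length_pos_iff.mpr hPs.ne_nil
  have hnd : (c :: (P ++ (A ++ ([z] ++ B)))).Nodup := by
    rw [List.nodup_cons, List.mem_append, List.nodup_append]
    refine ⟨?_, hPn, h.nodup, ?_⟩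
    · rintro (h' | h')
      · exact (hP c h').2 hcK
      · exact h.not_free c h' hc
    · rintro v hv w hw rfl
      exact h.not_free v hw (hP v hv).1
  have htot := outCount_le (K := K) (List.nodup_cons.mp hnd).2
  have hcnt := h.count
  simp only [outCount_append, inCount_append, outCount_cons, inCount_cons, outCount_nil,
    inCount_nil, hzK, if_false, outCount_eq_length fun v hv => (hP v hv).2] at htot hcnt
  have hA1 := inCount_pos hA.mem_left hx
  have hB1 := inCount_pos hB.mem_right hy
  have hAin : inCount K A = 1 := by omega
  have hBin : inCount K B = 1 := by omega
  have hlA := inCount_add_outCount (K := K) (l := A)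
  have hlB := inCount_add_outCount (K := K) (l := B)
  obtain ⟨a, rfl⟩ := List.length_eq_one_iff.mp (show P.length = 1 by omega)
  obtain ⟨rfl, rfl⟩ := hPs.of_singleton
  obtain ⟨a₁, a₂, a₃, rfl⟩ := List.length_eq_three.mp (show A.length = 3 by omega)
  obtain ⟨b₁, b₂, b₃, rfl⟩ := List.length_eq_three.mp (show B.length = 3 by omega)
  obtain ⟨rfl, ha₁, hA⟩ := hA.of_cons_cons
  obtain ⟨-, ha₂, hA⟩ := hA.of_cons_cons
  obtain ⟨-, rfl⟩ := hA.of_singleton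
  obtain ⟨rfl, hb₁, hB⟩ := hB.of_cons_cons
  obtain ⟨-, hb₂, hB⟩ := hB.of_cons_cons
  obtain ⟨-, rfl⟩ := hB.of_singleton
  have hdK := (hP d' (by simp)).2
  have hS6 : Kᶜ.card = 6 := by omega
  simp only [inCount_cons, inCount_nil, hx, hy, if_true] at hAin hBin
  have ha₂K : a₂ ∉ K := by
    intro h'
    simp only [h', if_true] at hAin
    omega
  have hpK : p ∉ K := by
    intro h'
    simp only [h', if_true] at hAin
    omega
  have hb₂K : b₂ ∉ K := by
    intro h'
    simp only [h', if_true] at hBin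
    omega
  have hqK : q ∉ K := by
    intro h'
    simp only [h', if_true] at hBin
    omega
  have hnodup : [x, y, c, a₂, p, z, q, b₂, d'].Nodup := by
    refine (List.Perm.nodup_iff ?_).mp hnd
    rw [List.perm_iff_count]
    intro u
    simp only [List.count_append, List.count_cons, List.count_nil]
    ring
  have hF : [a₂, p, z, q, b₂, d'].toFinset = Kᶜ := by
    refine Finset.eq_of_subset_of_card_le ?_ ?_
    · intro v hv
      simp only [List.mem_toFinset, List.mem_cons, List.not_mem_nil, or_false] at hv
      rw [Finset.mem_compl]
      rcases hv with rfl | rfl | rfl | rfl | rfl | rfl <;> assumption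
    · rw [List.toFinset_card_of_nodup (hnodup.sublist (by
        exact .cons _ (.cons _ (.cons _ (.refl _)))))]
      simpa using hS
  have hcfg : IsExtremalConfig G K x y c a₂ p z q b₂ d' :=
    { clawFree := hclaw, isolated := hK, two_le := h2, attached := hatt hS6, no_cycle := hno,
      x_mem := hx, y_mem := hy, c_mem := hcK, nodup := hnodup,
      not_mem_iff := fun v => by rw [← List.mem_toFinset, hF, Finset.mem_compl]
      x_w₁ := ha₁, w₁_w₂ := ha₂, w₂_w₃ := hpz, w₃_w₄ := hzq, w₄_w₅ := hb₁, w₅_y := hb₂,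
      w₂_w₄ := hpq, w₃_d := hzd, d_c := hdc }
  exact hcfg.nonempty_iso hn

/-- A short tight link has no two vertices joined by a path of free vertices. -/
lemma IsTightLink.false_of_two {Free : V → Prop} {W P : List V} {z z' : V} (hclaw : ClawFree G)
    (hK : IsIsolatedClique G K) (hS : Kᶜ.card ≤ 5) (h : IsTightLink G K Free W)
    (hz : z ∈ W) (hzK : z ∉ K) (hz' : z' ∈ W) (hzK' : z' ∉ K) (hne : z ≠ z')
    (hP : ∀ v ∈ P, Free v ∧ v ∉ K) (hPn : P.Nodup) (hPs : IsSeg G d d' P) (hzd : G.Adj z d)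
    (hdz : G.Adj d' z') : False := by
  have hd := hP d hPs.mem_left
  have h3 := h.three_le_outCount hclaw hK hz hzK hd.1 hd.2 hzd
  have hPlen := List.length_pos_iff.mpr hPs.ne_nil
  have htot : P.length + outCount K W ≤ 5 := by
    have := outCount_le (K := K) (l := P ++ W) (by
      rw [List.nodup_append]
      refine ⟨hPn, h.nodup, ?_⟩
      rintro v hv w hw rfl
      exact h.not_free v hw (hP v hv).1)
    rw [outCount_append, outCount_eq_length fun v hv => (hP v hv).2] at this
    omega
  obtain ⟨x, y, p, q, M, hx, hy, hxy, rfl, hM, hxp, hs, hqy, hlen⟩ := h.exists_eq h.nodup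
  have hmem : ∀ {z}, z ∈ [x] ++ (M ++ [y]) → z ∉ K → z ∈ M := by
    intro z hz hzK
    simp only [List.mem_append, List.mem_singleton] at hz
    rcases hz with rfl | hz | rfl
    · exact absurd hx hzK
    · exact hz
    · exact absurd hy hzK
  replace hz := hmem hz hzK
  replace hz' := hmem hz' hzK'
  rw [hlen] at h3 htot
  have hPn' := List.nodup_reverse.mpr hPn
  have hP' : ∀ v ∈ P.reverse, Free v ∧ v ∉ K := fun v hv => hP v (List.mem_reverse.mp hv)
  rcases M with _ | ⟨w₁, _ | ⟨w₂, _ | ⟨w₃, _ | ⟨w₄, _ | ⟨w₅, M⟩⟩⟩⟩⟩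
  · simp at h3
  · simp at h3
  · simp at h3
  · obtain ⟨rfl, h₁₂, hs⟩ := hs.of_cons_cons
    obtain ⟨-, h₂₃, hs⟩ := hs.of_cons_cons
    obtain ⟨-, rfl⟩ := hs.of_singleton
    have key : ∀ {z z' d d' : V} {P : List V}, (∀ v ∈ P, Free v ∧ v ∉ K) → P.Nodup →
        IsSeg G d d' P → G.Adj z d → G.Adj d' z' →
        (z = p ∧ z' = w₂ ∨ z = p ∧ z' = q ∨ z = w₂ ∧ z' = q) → False := by
      rintro z z' d d' P hP hPn hPs hzd hdz (⟨rfl, rfl⟩ | ⟨rfl, rfl⟩ | ⟨rfl, rfl⟩)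
      · exact h.false_of_insert (A := [x, z]) (B := [z', q, y]) hP hPn hPs (.cons hxp (.single _))
          h₁₂ (.cons h₂₃ (.cons hqy (.single _))) hzd hdz
      · exact h.false_of_gap (A := [x]) (B := [z', y]) hclaw hP hPn hPs hzd hdz (.single _) hxp
          h₁₂ h₂₃ (.cons hqy (.single _))
      · exact h.false_of_insert (A := [x, p, z]) (B := [z', y]) hP hPn hPs
          (.cons hxp (.cons h₁₂ (.single _))) h₂₃ (.cons hqy (.single _)) hzd hdz
    simp only [List.mem_cons, List.not_mem_nil, or_false] at hz hz'
    by_cases ho : z = p ∧ z' = w₂ ∨ z = p ∧ z' = q ∨ z = w₂ ∧ z' = q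
    · exact key hP hPn hPs hzd hdz ho
    · exact key hP' hPn' hPs.reverse hdz.symm hzd.symm (by grind)
  · obtain ⟨rfl, h₁₂, hs⟩ := hs.of_cons_cons
    obtain ⟨-, h₂₃, hs⟩ := hs.of_cons_cons
    obtain ⟨-, h₃₄, hs⟩ := hs.of_cons_cons
    obtain ⟨-, rfl⟩ := hs.of_singleton
    have key : ∀ {z z' d d' : V} {P : List V}, (∀ v ∈ P, Free v ∧ v ∉ K) → P.Nodup →
        IsSeg G d d' P → G.Adj z d → G.Adj d' z' →
        (z = p ∧ z' = w₂ ∨ z = p ∧ z' = w₃ ∨ z = p ∧ z' = q ∨ z = w₂ ∧ z' = w₃ ∨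
          z = w₂ ∧ z' = q ∨ z = w₃ ∧ z' = q) → False := by
      rintro z z' d d' P hP hPn hPs hzd hdz
        (⟨rfl, rfl⟩ | ⟨rfl, rfl⟩ | ⟨rfl, rfl⟩ | ⟨rfl, rfl⟩ | ⟨rfl, rfl⟩ | ⟨rfl, rfl⟩)
      · exact h.false_of_insert (A := [x, z]) (B := [z', w₃, q, y]) hP hPn hPs
          (.cons hxp (.single _)) h₁₂ (.cons h₂₃ (.cons h₃₄ (.cons hqy (.single _)))) hzd hdz
      · exact h.false_of_gap (A := [x]) (B := [z', q, y]) hclaw hP hPn hPs hzd hdz (.single _) hxp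
          h₁₂ h₂₃ (.cons h₃₄ (.cons hqy (.single _)))
      · have hd := hP d hPs.mem_left
        have hd' := hP d' hPs.mem_right
        have e₁ := h.adj_of_adj_free (A := [x]) (B := [w₂, w₃, z', y]) hclaw (.single x) hxp h₁₂
          (.cons h₂₃ (.cons h₃₄ (.cons hqy (.single _)))) hd.1 hd.2 hzd
        have e₂ := h.adj_of_adj_free (A := [x, z, w₂, w₃]) (B := [y]) hclaw
          (.cons hxp (.cons h₁₂ (.cons h₂₃ (.single _)))) h₃₄ hqy (.single y) hd'.1 hd'.2 hdz.symm
        refine h.false_of_perm hP hPn hPs.ne_nil hx hy (IsSeg.append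
          (.cons e₁ (.cons h₁₂.symm (.single z))) hzd (hPs.append hdz
            (.cons h₃₄.symm (.cons e₂ (.single y))))) ?_
        rw [List.perm_iff_count]
        intro u
        simp only [List.count_append, List.count_cons, List.count_nil]
        ring
      · exact h.false_of_insert (A := [x, p, z]) (B := [z', q, y]) hP hPn hPs
          (.cons hxp (.cons h₁₂ (.single _))) h₂₃ (.cons h₃₄ (.cons hqy (.single _))) hzd hdz
      · exact h.false_of_gap (A := [x, p]) (B := [z', y]) hclaw hP hPn hPs hzd hdz
          (.cons hxp (.single _)) h₁₂ h₂₃ h₃₄ (.cons hqy (.single _))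
      · exact h.false_of_insert (A := [x, p, w₂, z]) (B := [z', y]) hP hPn hPs
          (.cons hxp (.cons h₁₂ (.cons h₂₃ (.single _)))) h₃₄ (.cons hqy (.single _)) hzd hdz
    simp only [List.mem_cons, List.not_mem_nil, or_false] at hz hz'
    by_cases ho : z = p ∧ z' = w₂ ∨ z = p ∧ z' = w₃ ∨ z = p ∧ z' = q ∨ z = w₂ ∧ z' = w₃ ∨
          z = w₂ ∧ z' = q ∨ z = w₃ ∧ z' = q
    · exact key hP hPn hPs hzd hdz ho
    · exact key hP' hPn' hPs.reverse hdz.symm hzd.symm (by grind)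
  · simp only [List.length_cons] at htot
    omega

/-- A 2-connected claw-free graph with at most six vertices outside a large isolated clique is
Hamiltonian or `EP`. -/
theorem nonempty_iso_of_isIsolatedClique (h2 : TwoConnected G) (hclaw : ClawFree G)
    (hK : IsIsolatedClique G K) (hK2 : 2 ≤ K.card) (hS : Kᶜ.card ≤ 6)
    (hatt : Kᶜ.card = 6 → ∀ s ∉ K, ∃ a ∈ K, G.Adj s a) (hno : ¬ HasHamList G) {n : ℕ}
    (hn : Fintype.card V = n) : Nonempty (G ≃g EPgraph n) := by
  obtain ⟨Ls, h, hmax, d₀, hd₀K, hd₀⟩ := exists_max_linkSystem h2.1 hK.adj hno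
  set D : V → Prop := ReachIn G (fun v => v ∉ Ls.flatten ∧ v ∉ K) d₀ with hD
  have hDd₀ : D d₀ := ReachIn.refl ⟨hd₀, hd₀K⟩
  obtain ⟨k₁, hk₁, k₂, hk₂, hk⟩ := Finset.one_lt_card.mp (show 1 < K.card by omega)
  have hDK : ∀ {u}, D u → u ∉ K := fun hu => hu.prop.2
  have hcov : ∀ {u z}, D u → ¬ D z → G.Adj u z → z ∉ K → ∃ W ∈ Ls, z ∈ W := by
    intro u z hu hz huz hzK
    rw [← List.mem_flatten]
    by_contra hzL
    exact hz (hu.step huz ⟨hzL, hzK⟩)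
  obtain ⟨u, z, u', z', hu, hz, huz, hu', hz', huz', hzz⟩ := h2.exists_two_boundary hDd₀
    (fun h' => hDK h' hk₁) (fun h' => hDK h' hk₂) hk
  by_cases hatD : ∃ t c, D t ∧ c ∈ K ∧ G.Adj t c
  · obtain ⟨t, c, ht, hcK, htc⟩ := hatD
    have hfree : ∀ {t c}, D t → c ∈ K → G.Adj t c → c ∉ Ls.flatten := by
      intro t c ht hcK htc hcL
      obtain ⟨W, hW, hcW⟩ := List.mem_flatten.mp hcL
      exact (h.isTightLink hmax hW).mem_of_adj_free hclaw hK hK2 ht.prop.1 ht.prop.2 hcK htc hcW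
    have huniq : ∀ {t' c'}, D t' → c' ∈ K → G.Adj t' c' → c' = c := by
      intro t' c' ht' hcK' htc'
      by_contra hcc
      obtain ⟨P, hPs, hPn, hP⟩ := ht.exists_path ht'
      have hPo := outCount_eq_length fun v hv => (hP v hv).2
      have hPi : inCount K P = 0 := inCount_eq_zero.mpr fun v hv => (hP v hv).2
      have hPlen := List.length_pos_iff.mpr hPs.ne_nil
      have hcP : c ∉ P := fun h' => (hP c h').2 hcK
      have hcP' : c' ∉ P := fun h' => (hP c' h').2 hcK'
      have hNf : ∀ v ∈ [c] ++ (P ++ [c']), v ∉ Ls.flatten := by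
        intro v hv
        simp only [List.mem_append, List.mem_singleton] at hv
        rcases hv with rfl | hv | rfl
        · exact hfree ht hcK htc
        · exact (hP v hv).1
        · exact hfree ht' hcK' htc'
      have hNn : ([c] ++ (P ++ [c'])).Nodup := by
        simp only [List.nodup_append, List.mem_append, List.mem_singleton, List.nodup_singleton]
        grind
      have := hmax (([c] ++ (P ++ [c'])) :: Ls) ⟨?_, ?_⟩
      · rw [List.flatten_cons, outCount_append, outCount_append, outCount_append, hPo] at this
        omega
      · intro l hl
        rcases List.mem_cons.mp hl with rfl | hl
        · exact ⟨⟨c, c', hcK, hcK', (IsSeg.single c).append htc.symm (hPs.snoc htc')⟩,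
            by simp [hPi, hcK, hcK'], by simp [hPo, hcK, hcK']; omega⟩
        · exact h.link l hl
      · rw [List.flatten_cons, List.nodup_append]
        refine ⟨hNn, h.nodup, ?_⟩
        rintro v hv w hw rfl
        exact hNf v hv hw
    obtain ⟨u₁, z₁, hu₁, hz₁, huz₁, hzc⟩ : ∃ u₁ z₁, D u₁ ∧ ¬ D z₁ ∧ G.Adj u₁ z₁ ∧ z₁ ≠ c := by
      by_cases e : z = c
      · exact ⟨u', z', hu', hz', huz', fun e' => hzz (e.trans e'.symm)⟩
      · exact ⟨u, z, hu, hz, huz, e⟩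
    have hzK : z₁ ∉ K := fun h' => hzc (huniq hu₁ h' huz₁)
    obtain ⟨W, hW, hzW⟩ := hcov hu₁ hz₁ huz₁ hzK
    obtain ⟨P, hPs, hPn, hP⟩ := hu₁.exists_path ht
    exact (h.isTightLink hmax hW).nonempty_iso hclaw hK hK2 hS hatt hno hzW hzK hP hPn hPs
      huz₁.symm htc hcK (hfree ht hcK htc) hn
  · push Not at hatD
    exfalso
    have hS5 : Kᶜ.card ≤ 5 := by
      by_contra hlt
      obtain ⟨a, ha, h'⟩ := hatt (by omega) d₀ hd₀K
      exact hatD d₀ a hDd₀ ha h'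
    have hzK : z ∉ K := fun h' => hatD u z hu h' huz
    have hzK' : z' ∉ K := fun h' => hatD u' z' hu' h' huz'
    obtain ⟨W, hW, hzW⟩ := hcov hu hz huz hzK
    obtain ⟨W', hW', hzW'⟩ := hcov hu' hz' huz' hzK'
    by_cases hWW : W = W'
    · subst hWW
      obtain ⟨P, hPs, hPn, hP⟩ := hu.exists_path hu'
      exact (h.isTightLink hmax hW).false_of_two hclaw hK hS5 hzW hzK hzW' hzK' hzz hP hPn hPs
        huz.symm huz'
    · have h₁ := (h.isTightLink hmax hW).three_le_outCount hclaw hK hzW hzK hu.prop.1 hu.prop.2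
        huz.symm
      have h₂ := (h.isTightLink hmax hW').three_le_outCount hclaw hK hzW' hzK' hu'.prop.1
        hu'.prop.2 huz'.symm
      have hle : ∀ {L : List (List V)} {l}, l ∈ L → outCount K l ≤ outCount K L.flatten :=
        fun hl => (List.sublist_flatten_of_mem hl).countP_le
      have := outCount_le (K := K) h.nodup
      obtain ⟨L₁, L₂, rfl⟩ := List.append_of_mem hW
      rw [List.flatten_append, List.flatten_cons, outCount_append, outCount_append] at this
      simp only [List.mem_append, List.mem_cons] at hW'
      rcases hW' with h' | rfl | h'
      · have := hle h'
        omega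
      · exact hWW rfl
      · have := hle h'
        omega

end

section

variable {V : Type*} [Fintype V] [DecidableEq V] {G : SimpleGraph V}

lemma TwoConnected.connected (h : TwoConnected G) : G.Connected := by
  have hne : Nonempty V := Fintype.card_pos_iff.mp (by have := h.1; omega)
  refine ⟨fun u v => ?_⟩
  obtain ⟨c, -, hc⟩ := Finset.exists_mem_notMem_of_card_lt_card
    (s := {u, v}) (t := Finset.univ) (Finset.card_le_two.trans_lt h.1)
  simp only [Finset.mem_insert, Finset.mem_singleton, not_or] at hc
  exact ((h.2 c).preconnected ⟨u, fun e => hc.1 e.symm⟩ ⟨v, fun e => hc.2 e.symm⟩).map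
    (Embedding.induce _).toHom

/-- The dichotomy for graphs without eligible vertices. -/
lemma hasHamList_or_nonempty_iso_of_not_eligible {n : ℕ} (hn : 33 ≤ n) (hV : Fintype.card V = n)
    (h2 : TwoConnected G) (hclaw : ClawFree G)
    (hmu : adjSpectralRadius (EPgraph n) ≤ adjSpectralRadius G) (he : ∀ x, ¬ Eligible G x) :
    HasHamList G ∨ Nonempty (G ≃g EPgraph n) := by
  obtain ⟨m, rfl⟩ : ∃ m, n = m + 6 := ⟨n - 6, by omega⟩
  have hm : 27 ≤ m := by omega
  have hm' : (27 : ℝ) ≤ m := by exact_mod_cast hm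
  have hpos : 0 < ((m : ℝ) - 1) ^ 3 := by
    have : (0 : ℝ) < (m : ℝ) - 1 := by linarith
    positivity
  have hle := (le_adjSpectralRadius_EPgraph hm).trans (mul_le_mul_of_nonneg_right hmu hpos.le)
  have hlt : (m : ℝ) - 1 < adjSpectralRadius G := by
    refine lt_of_mul_lt_mul_right (lt_of_lt_of_le ?_ hle) hpos.le
    linarith
  have hT : LocallyTransitive G := fun x s y z hs hy hz hsy hyz hsz =>
    hclaw.adj_trans_of_not_eligible (he x) hs hy hz hsy hyz hsz
  obtain ⟨K, hK, hKm⟩ := exists_large_isIsolatedClique hclaw hT hm hV hlt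
  have hc := Finset.card_compl K
  refine or_iff_not_imp_left.mpr fun hno => nonempty_iso_of_isIsolatedClique h2 hclaw hK (by omega)
    (by omega) (fun h6 s hs => ?_) hno hV
  obtain rfl : K.card = m := by have := Finset.card_le_univ K; omega
  exact exists_adj_of_card_compl_eq_six hK.adj hK.unique hm h6 hle hs

theorem hasHamList_or_nonempty_iso {n : ℕ} (hn : 33 ≤ n) (hV : Fintype.card V = n)
    (h2 : TwoConnected G) (hclaw : ClawFree G)
    (hmu : adjSpectralRadius (EPgraph n) ≤ adjSpectralRadius G) :
    HasHamList G ∨ Nonempty (G ≃g EPgraph n) := by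
  induction G using WellFoundedGT.induction with
  | ind G ih =>
    by_cases he : ∀ x, ¬ Eligible G x
    · exact hasHamList_or_nonempty_iso_of_not_eligible hn hV h2 hclaw hmu he
    push Not at he
    obtain ⟨x, hx, u, v, hu, hv, huv, hnuv⟩ := he
    have hle := le_localCompletion G x
    have hlt : G < localCompletion G x := lt_of_le_not_ge hle fun h =>
      hnuv (h ((localCompletion_adj).mpr (Or.inr ⟨huv, hu, hv⟩)))
    have : Nonempty V := ⟨x⟩
    have : Nonempty (Fin n) := ⟨⟨0, by omega⟩⟩
    have h2' := h2.mono hle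
    have hmu' := adjSpectralRadius_lt hlt h2'.connected
    rcases ih _ hlt h2' (hclaw.localCompletion x) (hmu.trans hmu'.le) with h | ⟨⟨e⟩⟩
    · exact Or.inl (hasHamList_of_localCompletion h2.1 hclaw hx h)
    · exact absurd (adjSpectralRadius_eq_of_iso e) (hmu.trans_lt hmu').ne'

end

theorem statement_1 {V : Type*} [Fintype V] [DecidableEq V] (G : SimpleGraph V) (n : ℕ)
    (hn : 33 ≤ n) (hcard : Fintype.card V = n)
    (h2conn : TwoConnected G) (hclaw : ClawFree G)
    (hmu : adjSpectralRadius G ≥ adjSpectralRadius (EPgraph n)) :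
    G.IsHamiltonian ∨ Nonempty (G ≃g EPgraph n) :=
  (hasHamList_or_nonempty_iso hn hcard h2conn hclaw hmu).imp_left
    fun h => h.isHamiltonian h2conn.1
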